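/- For all infinite cardinals λ and μ, if λ < h(L^{II}_{μ,ω}) then h(L^c_{λ⁺,ω}) < h(L^{II}_{μ,ω}); in particular h(L^c_{λ⁺,ω}) < h(L^{II}_{λ⁺,ω}). -/

import Mathlib

open FirstOrder Cardinal

namespace Hanf

/-- Formulas of (extensions of) infinitary first-order logic over a vocabulary `L`:
first-order logic with equality, infinitary conjunctions, monadic second-order
(set) variables, binary relation variables, and the quantifiers
`wo` (well-ordering), `∃^c` (countable set), `aa` (stationary), `∃R` (second order),
and `Q^{cf}_{ℵ₀}` (countable cofinality). -/
inductive Fml (L : FirstOrder.Language.{0,0}) : Type 1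
  | rel : {n : ℕ} → L.Relations n → (Fin n → L.Term ℕ) → Fml L
  | eq : L.Term ℕ → L.Term ℕ → Fml L
  | mem : ℕ → L.Term ℕ → Fml L
  | rmem : ℕ → L.Term ℕ → L.Term ℕ → Fml L
  | not : Fml L → Fml L
  | conj : (ι : Type) → (ι → Fml L) → Fml L
  | all : ℕ → Fml L → Fml L
  | qWo : ℕ → ℕ → Fml L → Fml L
  | qC : ℕ → Fml L → Fml L
  | qAA : ℕ → Fml L → Fml L
  | qII : ℕ → Fml L → Fml L
  | qCf : ℕ → ℕ → Fml L → Fml L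

variable {L : FirstOrder.Language.{0,0}}

/-- A family of countable subsets of `M` which is closed under unions of countable
increasing chains and cofinal (under `⊆`) in the countable subsets of `M`. -/
def IsClubFam {M : Type} (C : Set (Set M)) : Prop :=
  (∀ S ∈ C, S.Countable) ∧
  (∀ f : ℕ → Set M, (∀ n, f n ∈ C) → Monotone f → (⋃ n, f n) ∈ C) ∧
  (∀ S : Set M, S.Countable → ∃ T ∈ C, S ⊆ T)

/-- The field of a binary relation. -/
def fieldOf {M : Type} (r : M → M → Prop) : Set M :=
  {a | (∃ b, r a b) ∨ ∃ b, r b a}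

/-- `r` well-orders its field. -/
def WellOrdersField {M : Type} (r : M → M → Prop) : Prop :=
  IsWellOrder (fieldOf r) (fun a b => r a.1 b.1)

/-- `r` is a linear order of its field, of cofinality `ℵ₀`:
it is irreflexive, transitive and trichotomous on its field, some countable
sequence is cofinal in it, and it has no maximal element. -/
def LinearOrdersFieldCofOmega {M : Type} (r : M → M → Prop) : Prop :=
  (∀ a ∈ fieldOf r, ¬ r a a) ∧
  (∀ a ∈ fieldOf r, ∀ b ∈ fieldOf r, ∀ c ∈ fieldOf r, r a b → r b c → r a c) ∧
  (∀ a ∈ fieldOf r, ∀ b ∈ fieldOf r, a ≠ b → r a b ∨ r b a) ∧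
  (∃ c : ℕ → M, (∀ n, c n ∈ fieldOf r) ∧ ∀ a ∈ fieldOf r, ∃ n, a = c n ∨ r a (c n)) ∧
  (∀ a ∈ fieldOf r, ∃ b ∈ fieldOf r, r a b)

/-- Satisfaction, relative to assignments of the first-order variables,
the monadic (set) variables and the binary relation variables. -/
def Eval {M : Type} [L.Structure M] :
    Fml L → (ℕ → M) → (ℕ → Set M) → (ℕ → M → M → Prop) → Prop
  | .rel R ts, va, _, _ => Language.Structure.RelMap R (fun i => (ts i).realize va)
  | .eq t₁ t₂, va, _, _ => t₁.realize va = t₂.realize va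
  | .mem X t, va, vs, _ => t.realize va ∈ vs X
  | .rmem R t₁ t₂, va, _, vr => vr R (t₁.realize va) (t₂.realize va)
  | .not φ, va, vs, vr => ¬ Eval φ va vs vr
  | .conj _ f, va, vs, vr => ∀ i, Eval (f i) va vs vr
  | .all x φ, va, vs, vr => ∀ a, Eval φ (Function.update va x a) vs vr
  | .qWo x y φ, va, vs, vr =>
      WellOrdersField (fun a b =>
        Eval φ (Function.update (Function.update va x a) y b) vs vr)
  | .qC X φ, va, vs, vr => ∃ S : Set M, S.Countable ∧ Eval φ va (Function.update vs X S) vr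
  | .qAA X φ, va, vs, vr =>
      ∃ C : Set (Set M), IsClubFam C ∧ ∀ S ∈ C, Eval φ va (Function.update vs X S) vr
  | .qII R φ, va, vs, vr => ∃ r : M → M → Prop, Eval φ va vs (Function.update vr R r)
  | .qCf x y φ, va, vs, vr =>
      LinearOrdersFieldCofOmega (fun a b =>
        Eval φ (Function.update (Function.update va x a) y b) vs vr)

/-- The variables of a term. -/
def tvars : L.Term ℕ → Set ℕ
  | .var i => {i}
  | .func _ ts => ⋃ i, tvars (ts i)

/-- Free first-order variables. -/
def fv : Fml L → Set ℕ
  | .rel _ ts => ⋃ i, tvars (ts i)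
  | .eq t₁ t₂ => tvars t₁ ∪ tvars t₂
  | .mem _ t => tvars t
  | .rmem _ t₁ t₂ => tvars t₁ ∪ tvars t₂
  | .not φ => fv φ
  | .conj _ f => ⋃ i, fv (f i)
  | .all x φ => fv φ \ {x}
  | .qWo x y φ => fv φ \ {x, y}
  | .qC _ φ => fv φ
  | .qAA _ φ => fv φ
  | .qII _ φ => fv φ
  | .qCf x y φ => fv φ \ {x, y}

/-- Free monadic (set) variables. -/
def sv : Fml L → Set ℕ
  | .rel _ _ => ∅
  | .eq _ _ => ∅
  | .mem X _ => {X}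
  | .rmem _ _ _ => ∅
  | .not φ => sv φ
  | .conj _ f => ⋃ i, sv (f i)
  | .all _ φ => sv φ
  | .qWo _ _ φ => sv φ
  | .qC X φ => sv φ \ {X}
  | .qAA X φ => sv φ \ {X}
  | .qII _ φ => sv φ
  | .qCf _ _ φ => sv φ

/-- Free binary relation variables. -/
def rv : Fml L → Set ℕ
  | .rel _ _ => ∅
  | .eq _ _ => ∅
  | .mem _ _ => ∅
  | .rmem R _ _ => {R}
  | .not φ => rv φ
  | .conj _ f => ⋃ i, rv (f i)
  | .all _ φ => rv φ
  | .qWo _ _ φ => rv φ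
  | .qC _ φ => rv φ
  | .qAA _ φ => rv φ
  | .qII R φ => rv φ \ {R}
  | .qCf _ _ φ => rv φ

/-- A sentence: no free variables of any kind. -/
def IsSentence (φ : Fml L) : Prop := fv φ = ∅ ∧ sv φ = ∅ ∧ rv φ = ∅

/-- Which extra quantifiers a logic allows, and the bound on the size
of its conjunctions (`conjBound = ℵ₀` gives finitary logic). -/
structure Allowed where
  wo : Prop
  c : Prop
  aa : Prop
  ii : Prop
  cf : Prop
  conjBound : Cardinal.{0}

/-- The formula lies in the logic described by `A`. -/
def Ok (A : Allowed) : Fml L → Prop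
  | .rel _ _ => True
  | .eq _ _ => True
  | .mem _ _ => True
  | .rmem _ _ _ => True
  | .not φ => Ok A φ
  | .conj ι f => #ι < A.conjBound ∧ ∀ i, Ok A (f i)
  | .all _ φ => Ok A φ
  | .qWo _ _ φ => A.wo ∧ Ok A φ
  | .qC _ φ => A.c ∧ Ok A φ
  | .qAA _ φ => A.aa ∧ Ok A φ
  | .qII _ φ => A.ii ∧ Ok A φ
  | .qCf _ _ φ => A.cf ∧ Ok A φ

/-- `M ⊨ φ` (for sentences this does not depend on the assignments). -/
def Sat (M : Type) [L.Structure M] (φ : Fml L) : Prop :=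
  ∀ (va : ℕ → M) (vs : ℕ → Set M) (vr : ℕ → M → M → Prop), Eval φ va vs vr

/-- `h(φ) < ∞`: `φ` has no models of arbitrarily large cardinality. -/
def BddSpec (φ : Fml L) : Prop :=
  ∃ κ : Cardinal, ∀ (M : Type) (S : L.Structure M), @Sat L M S φ → #M < κ

/-- The Hanf value `h(φ) = sup {|M|⁺ : M ⊨ φ}`. -/
noncomputable def hanfVal (φ : Fml L) : Cardinal :=
  sSup {c | ∃ (M : Type) (S : L.Structure M), @Sat L M S φ ∧ c = Order.succ #M}

/-- The Hanf number of the logic `A`: the supremum of `h(φ)` over all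
sentences `φ` of the logic (in any vocabulary) with `h(φ) < ∞`. -/
noncomputable def hanfNum (A : Allowed) : Cardinal :=
  sSup {c | ∃ (L : FirstOrder.Language.{0,0}) (φ : Fml L),
    IsSentence φ ∧ Ok A φ ∧ BddSpec φ ∧ c = hanfVal φ}

/-- The Hanf number of the logic `A` computed over vocabularies of cardinality `≤ χ`. -/
noncomputable def hanfNumVocab (A : Allowed) (χ : Cardinal) : Cardinal :=
  sSup {c | ∃ (L : FirstOrder.Language.{0,0}), L.card ≤ χ ∧ ∃ φ : Fml L,
    IsSentence φ ∧ Ok A φ ∧ BddSpec φ ∧ c = hanfVal φ}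

/-- `L^{wo}_{ω,ω}`. -/
def Lwo : Allowed := ⟨True, False, False, False, False, ℵ₀⟩
/-- `L^c_{ω,ω}`. -/
def Lc : Allowed := ⟨False, True, False, False, False, ℵ₀⟩
/-- `L^{aa}_{ω,ω}`. -/
def Laa : Allowed := ⟨False, False, True, False, False, ℵ₀⟩
/-- `L^{II}_{ω,ω}`. -/
def LII : Allowed := ⟨False, False, False, True, False, ℵ₀⟩
/-- `L_{ω,ω}(Q^{cf}_{ℵ₀})`. -/
def Lcf : Allowed := ⟨False, False, False, False, True, ℵ₀⟩
/-- `L^{wo}_{κ,ω}`: conjunctions of `< κ` formulas. -/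
def LwoInf (κ : Cardinal) : Allowed := ⟨True, False, False, False, False, κ⟩
/-- `L^c_{κ,ω}`. -/
def LcInf (κ : Cardinal) : Allowed := ⟨False, True, False, False, False, κ⟩
/-- `L^{II}_{κ,ω}`. -/
def LIIInf (κ : Cardinal) : Allowed := ⟨False, False, False, True, False, κ⟩


/-! ### Enumerations by a fixed infinite type -/

/-- `S` can be enumerated by `K`. -/
def Enum (K : Type) {α : Type*} (S : Set α) : Prop :=
  ∃ g : K → Option α, ∀ x ∈ S, ∃ k, g k = some x

section EnumLemmas
universe uα
variable {K : Type} {α : Type uα}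

theorem Enum.mono {S T : Set α} (h : Enum K T) (hST : S ⊆ T) : Enum K S := by
  obtain ⟨g, hg⟩ := h
  exact ⟨g, fun x hx => hg x (hST hx)⟩

theorem Enum.empty : Enum K (∅ : Set α) := ⟨fun _ => none, by simp⟩

theorem Enum.singleton [Nonempty K] (a : α) : Enum K ({a} : Set α) :=
  ⟨fun _ => some a, by rintro x rfl; exact ⟨Classical.arbitrary K, rfl⟩⟩

theorem Enum.iUnion [Infinite K] {ι : Type} (hι : Nonempty (ι ↪ K)) {S : ι → Set α}
    (h : ∀ i, Enum K (S i)) : Enum K (⋃ i, S i) := by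
  classical
  obtain ⟨j⟩ := hι
  choose g hg using h
  have hKK : #(K × K) = #K := by
    rw [Cardinal.mk_prod]
    simp [Cardinal.mul_eq_self (Cardinal.aleph0_le_mk K)]
  obtain ⟨e⟩ := Cardinal.eq.1 hKK
  refine ⟨fun k => if hh : ∃ i, j i = (e.symm k).1 then g hh.choose (e.symm k).2 else none, ?_⟩
  intro x hx
  obtain ⟨i, hi⟩ := Set.mem_iUnion.1 hx
  obtain ⟨k, hk⟩ := hg i x hi
  refine ⟨e (j i, k), ?_⟩
  have hh : ∃ i', j i' = (e.symm (e (j i, k))).1 := ⟨i, by simp⟩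
  beta_reduce
  rw [dif_pos hh]
  have : hh.choose = i := j.injective (hh.choose_spec.trans (by simp))
  rw [this]
  simpa using hk

theorem emb_of_finite [Infinite K] (ι : Type) [Finite ι] : Nonempty (ι ↪ K) := by
  rw [← Cardinal.le_def]
  exact (Cardinal.lt_aleph0_of_finite ι).le.trans (Cardinal.aleph0_le_mk K)

theorem Enum.union [Infinite K] {S T : Set α} (hS : Enum K S) (hT : Enum K T) :
    Enum K (S ∪ T) := by
  have := Enum.iUnion (K := K) (emb_of_finite Bool) (S := fun b => cond b S T)
    (by rintro (_ | _); exacts [hT, hS])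
  refine this.mono ?_
  rintro x (hx | hx)
  · exact Set.mem_iUnion.2 ⟨true, hx⟩
  · exact Set.mem_iUnion.2 ⟨false, hx⟩

theorem Enum.injOn [Nonempty K] {S : Set α} (h : Enum K S) : ∃ e : α → K, Set.InjOn e S := by
  classical
  obtain ⟨g, hg⟩ := h
  refine ⟨fun x => if hx : ∃ k, g k = some x then hx.choose else Classical.arbitrary K, ?_⟩
  intro x hx y hy hxy
  simp only [dif_pos (hg x hx), dif_pos (hg y hy)] at hxy
  have h1 := (hg x hx).choose_spec
  have h2 := (hg y hy).choose_spec
  rw [hxy, h2] at h1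
  exact (Option.some.inj h1).symm

end EnumLemmas

/-- The symbols of a term. -/
def tsym : L.Term ℕ → Set L.Symbols
  | .var _ => ∅
  | .func f ts => {Sum.inl ⟨_, f⟩} ∪ ⋃ i, tsym (ts i)

/-- The symbols of a formula. -/
def usym : Fml L → Set L.Symbols
  | .rel R ts => {Sum.inr ⟨_, R⟩} ∪ ⋃ i, tsym (ts i)
  | .eq t₁ t₂ => tsym t₁ ∪ tsym t₂
  | .mem _ t => tsym t
  | .rmem _ t₁ t₂ => tsym t₁ ∪ tsym t₂
  | .not φ => usym φ
  | .conj _ f => ⋃ i, usym (f i)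
  | .all _ φ => usym φ
  | .qWo _ _ φ => usym φ
  | .qC _ φ => usym φ
  | .qAA _ φ => usym φ
  | .qII _ φ => usym φ
  | .qCf _ _ φ => usym φ

theorem enum_tsym {K : Type} [Infinite K] (t : L.Term ℕ) : Enum K (tsym t) := by
  induction t with
  | var i => exact Enum.empty
  | func f ts ih => exact (Enum.singleton _).union (Enum.iUnion (emb_of_finite _) ih)

theorem emb_of_lt {K : Type} {ι : Type} {κ : Cardinal} (h : #ι < κ) (hκ : κ ≤ Order.succ #K) :
    Nonempty (ι ↪ K) := by
  rw [← Cardinal.le_def]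
  exact Order.lt_succ_iff.1 (h.trans_le hκ)

theorem enum_usym {K : Type} [Infinite K] {A : Allowed} (hA : A.conjBound ≤ Order.succ #K)
    (φ : Fml L) (hφ : Ok A φ) : Enum K (usym φ) := by
  induction φ with
  | rel R ts =>
    exact (Enum.singleton _).union (Enum.iUnion (emb_of_finite _) fun i => enum_tsym _)
  | eq t₁ t₂ => exact (enum_tsym _).union (enum_tsym _)
  | mem X t => exact enum_tsym _
  | rmem X t₁ t₂ => exact (enum_tsym _).union (enum_tsym _)
  | not φ ih => exact ih hφ
  | conj ι f ih => exact Enum.iUnion (emb_of_lt hφ.1 hA) fun i => ih i (hφ.2 i)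
  | all x φ ih => exact ih hφ
  | qWo x y φ ih => exact ih hφ.2
  | qC X φ ih => exact ih hφ.2
  | qAA X φ ih => exact ih hφ.2
  | qII X φ ih => exact ih hφ.2
  | qCf x y φ ih => exact ih hφ.2

/-! ### Boundedness of the set of Hanf values of second order logic -/

/-- A language with `K` many symbols of each arity. -/
def LK (K : Type) : FirstOrder.Language.{0,0} := ⟨fun _ => K, fun _ => K⟩

/-- Small copies of formulas. -/
inductive SC (K : Type) : Type
  | rel : (n : ℕ) → K → (Fin n → (LK K).Term ℕ) → SC K
  | eq : (LK K).Term ℕ → (LK K).Term ℕ → SC K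
  | mem : ℕ → (LK K).Term ℕ → SC K
  | rmem : ℕ → (LK K).Term ℕ → (LK K).Term ℕ → SC K
  | not : SC K → SC K
  | conj : (S : Set K) → (S → SC K) → SC K
  | all : ℕ → SC K → SC K
  | qII : ℕ → SC K → SC K

/-- The formula represented by a small copy. -/
def SC.dec {K : Type} : SC K → Fml (LK K)
  | .rel n R ts => .rel (L := LK K) (n := n) R ts
  | .eq t₁ t₂ => .eq t₁ t₂
  | .mem X t => .mem X t
  | .rmem X t₁ t₂ => .rmem X t₁ t₂
  | .not φ => .not φ.dec
  | .conj S f => .conj S fun i => (f i).dec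
  | .all x φ => .all x φ.dec
  | .qII X φ => .qII X φ.dec

/-- Agreement of two structures along a map of symbols. -/
def Agree {K : Type} (e : L.Symbols → K) (U : Set L.Symbols) (M : Type) (S : L.Structure M)
    (S₀ : (LK K).Structure M) : Prop :=
  (∀ (n : ℕ) (f : L.Functions n), Sum.inl ⟨n, f⟩ ∈ U →
    ∀ a, S.funMap f a = S₀.funMap (n := n) (e (Sum.inl ⟨n, f⟩)) a) ∧
  (∀ (n : ℕ) (R : L.Relations n), Sum.inr ⟨n, R⟩ ∈ U →
    ∀ a, S.RelMap R a ↔ S₀.RelMap (n := n) (e (Sum.inr ⟨n, R⟩)) a)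

theorem Agree.mono {K : Type} {e : L.Symbols → K} {U V : Set L.Symbols} {M : Type}
    {S : L.Structure M} {S₀ : (LK K).Structure M} (h : Agree e U M S S₀) (hVU : V ⊆ U) :
    Agree e V M S S₀ :=
  ⟨fun n f hf => h.1 n f (hVU hf), fun n R hR => h.2 n R (hVU hR)⟩

/-- Renaming of the symbols in a term. -/
def tmapK {K : Type} (e : L.Symbols → K) : L.Term ℕ → (LK K).Term ℕ
  | .var x => .var x
  | .func (l := n) f ts =>
    Language.Term.func (L := LK K) (l := n) (e (Sum.inl ⟨n, f⟩)) fun i => tmapK e (ts i)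

theorem realize_tmapK {K : Type} (e : L.Symbols → K) {M : Type} {S : L.Structure M}
    {S₀ : (LK K).Structure M} (va : ℕ → M) (t : L.Term ℕ) (h : Agree e (tsym t) M S S₀) :
    t.realize va = (tmapK e t).realize va := by
  induction t with
  | var x => rfl
  | func f ts ih =>
    have h1 : ∀ i, (ts i).realize va = (tmapK e (ts i)).realize va := fun i =>
      ih i (h.mono fun x hx => Or.inr (Set.mem_iUnion.2 ⟨i, hx⟩))
    simp only [tmapK, Language.Term.realize, h1]
    exact h.1 _ f (Or.inl rfl) _

theorem exists_SC {K : Type} {mu : Cardinal} (hmu : mu ≤ Order.succ #K) (e : L.Symbols → K)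
    (φ : Fml L) (hφ : Ok (LIIInf mu) φ) :
    ∃ c : SC K, ∀ (M : Type) (S : L.Structure M) (S₀ : (LK K).Structure M),
      Agree e (usym φ) M S S₀ → ∀ va vs vr,
        (@Eval L M S φ va vs vr ↔ @Eval (LK K) M S₀ c.dec va vs vr) := by
  classical
  induction φ with
  | @rel n R ts =>
    refine ⟨.rel n (e (Sum.inr ⟨n, R⟩)) fun i => tmapK e (ts i), fun M S S₀ h va vs vr => ?_⟩
    have h1 : ∀ i, (ts i).realize va = (tmapK e (ts i)).realize va := fun i =>
      realize_tmapK e va (ts i) (h.mono fun x hx => Or.inr (Set.mem_iUnion.2 ⟨i, hx⟩))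
    simp only [Eval, SC.dec, h1]
    exact h.2 n R (Or.inl rfl) _
  | eq t₁ t₂ =>
    refine ⟨.eq (tmapK e t₁) (tmapK e t₂), fun M S S₀ h va vs vr => ?_⟩
    simp only [Eval, SC.dec, realize_tmapK e va t₁ (h.mono fun x hx => Or.inl hx),
      realize_tmapK e va t₂ (h.mono fun x hx => Or.inr hx)]
  | mem X t =>
    refine ⟨.mem X (tmapK e t), fun M S S₀ h va vs vr => ?_⟩
    simp only [Eval, SC.dec, realize_tmapK e va t h]
  | rmem X t₁ t₂ =>
    refine ⟨.rmem X (tmapK e t₁) (tmapK e t₂), fun M S S₀ h va vs vr => ?_⟩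
    simp only [Eval, SC.dec, realize_tmapK e va t₁ (h.mono fun x hx => Or.inl hx),
      realize_tmapK e va t₂ (h.mono fun x hx => Or.inr hx)]
  | not φ ih =>
    obtain ⟨c, hc⟩ := ih hφ
    refine ⟨.not c, fun M S S₀ h va vs vr => ?_⟩
    simp only [Eval, SC.dec, hc M S S₀ h]
  | conj ι f ih =>
    choose c hc using fun i => ih i (hφ.2 i)
    obtain ⟨j⟩ := emb_of_lt hφ.1 hmu
    refine ⟨.conj (Set.range j) fun k => c k.2.choose, fun M S S₀ h va vs vr => ?_⟩
    have h1 : ∀ i, (@Eval L M S (f i) va vs vr ↔ @Eval (LK K) M S₀ (c i).dec va vs vr) :=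
      fun i => hc i M S S₀ (h.mono fun x hx => Set.mem_iUnion.2 ⟨i, hx⟩) va vs vr
    simp only [Eval, SC.dec, h1]
    constructor
    · intro h2 k
      exact h2 _
    · intro h2 i
      have h3 := h2 ⟨j i, i, rfl⟩
      have h4 : (⟨i, rfl⟩ : ∃ i', j i' = j i).choose = i :=
        j.injective (⟨i, rfl⟩ : ∃ i', j i' = j i).choose_spec
      rw [h4] at h3
      exact h3
  | all x φ ih =>
    obtain ⟨c, hc⟩ := ih hφ
    refine ⟨.all x c, fun M S S₀ h va vs vr => ?_⟩
    simp only [Eval, SC.dec, hc M S S₀ h]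
  | qII X φ ih =>
    obtain ⟨c, hc⟩ := ih hφ.2
    refine ⟨.qII X c, fun M S S₀ h va vs vr => ?_⟩
    simp only [Eval, SC.dec, hc M S S₀ h]
  | qWo x y φ ih => exact hφ.1.elim
  | qC X φ ih => exact hφ.1.elim
  | qAA X φ ih => exact hφ.1.elim
  | qCf x y φ ih => exact hφ.1.elim

theorem exists_agree_left {K : Type} (e : L.Symbols → K) (U : Set L.Symbols) {M : Type}
    (S₀ : (LK K).Structure M) : ∃ S : L.Structure M, Agree e U M S S₀ :=
  ⟨⟨fun {n} f a => S₀.funMap (n := n) (e (Sum.inl ⟨n, f⟩)) a,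
    fun {n} R a => S₀.RelMap (n := n) (e (Sum.inr ⟨n, R⟩)) a⟩,
    fun _ _ _ _ => rfl, fun _ _ _ _ => Iff.rfl⟩

theorem exists_agree_right {K : Type} (e : L.Symbols → K) (U : Set L.Symbols)
    (he : Set.InjOn e U) {M : Type} [Nonempty M]
    (S : L.Structure M) : ∃ S₀ : (LK K).Structure M, Agree e U M S S₀ := by
  classical
  refine ⟨⟨fun {n} (k : K) a => if h : ∃ f : L.Functions n, Sum.inl ⟨n, f⟩ ∈ U ∧
      e (Sum.inl ⟨n, f⟩) = k then S.funMap h.choose a else Classical.arbitrary M,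
    fun {n} (k : K) a => ∃ R : L.Relations n, Sum.inr ⟨n, R⟩ ∈ U ∧
      e (Sum.inr ⟨n, R⟩) = k ∧ S.RelMap R a⟩, ?_, ?_⟩
  · intro n f hf a
    have h : ∃ f' : L.Functions n, Sum.inl ⟨n, f'⟩ ∈ U ∧
      e (Sum.inl ⟨n, f'⟩) = e (Sum.inl ⟨n, f⟩) := ⟨f, hf, rfl⟩
    have h1 : h.choose = f := by
      have h2 := he h.choose_spec.1 hf h.choose_spec.2
      simpa using h2
    change S.funMap f a = dite _ _ _
    rw [dif_pos h, h1]
  · intro n R hR a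
    constructor
    · intro h
      exact ⟨R, hR, rfl, h⟩
    · rintro ⟨R', hR', h1, h2⟩
      have h3 := he hR' hR h1
      have h4 : R' = R := by simpa using h3
      rwa [h4] at h2

theorem bddAbove_hanf_II (mu : Cardinal.{0}) (hmu : ℵ₀ ≤ mu) :
    BddAbove {c | ∃ (L : FirstOrder.Language.{0,0}) (φ : Fml L),
      IsSentence φ ∧ Ok (LIIInf mu) φ ∧ BddSpec φ ∧ c = hanfVal φ} := by
  classical
  obtain ⟨K, hK⟩ : ∃ K : Type, #K = mu := ⟨mu.out, Cardinal.mk_out mu⟩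
  have : Infinite K := Cardinal.infinite_iff.2 (hK ▸ hmu)
  have hmu' : mu ≤ Order.succ #K := hK ▸ Order.le_succ _
  let g : SC K → Cardinal.{0} := fun c => max 1
    (sSup {d | ∃ (M : Type) (S : (LK K).Structure M), @Sat (LK K) M S c.dec ∧ Nonempty M ∧
      d = Order.succ #M})
  obtain ⟨b, hb⟩ : BddAbove (Set.range g) := Cardinal.bddAbove_of_small
  refine ⟨b, ?_⟩
  rintro x ⟨L, φ, -, hok, ⟨κ, hκ⟩, rfl⟩
  obtain ⟨e, he⟩ := (enum_usym (K := K) (A := LIIInf mu) hmu' φ hok).injOn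
  obtain ⟨c, hc⟩ := exists_SC hmu' e φ hok
  refine le_trans ?_ (hb ⟨c, rfl⟩)
  refine csSup_le' ?_
  rintro _ ⟨M, S, hM, rfl⟩
  rcases isEmpty_or_nonempty M with hE | hne
  · refine le_trans ?_ (le_max_left _ _)
    rw [Cardinal.mk_eq_zero]
    simp
  · refine le_trans ?_ (le_max_right _ _)
    obtain ⟨S₀, hS₀⟩ := exists_agree_right e (usym φ) he S
    refine le_csSup ?_ ⟨M, S₀, fun va vs vr => (hc M S S₀ hS₀ va vs vr).1 (hM va vs vr), hne, rfl⟩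
    refine ⟨κ, ?_⟩
    rintro _ ⟨M', S', hM', -, rfl⟩
    obtain ⟨S'', hS''⟩ := exists_agree_left e (usym φ) S'
    exact Order.succ_le_of_lt
      (hκ M' S'' fun va vs vr => (hc M' S'' S' hS'' va vs vr).2 (hM' va vs vr))

/-! ### Codes for infinitary sentences -/

/-- A code, with nodes and slots taken from `P`. -/
structure Code (P : Type) where
  con : P → Prop
  ch : P → P → Prop
  mt : P → P → P → Prop
  rt : P → Prop

/-- Local truth clauses. -/
def TClause {P A : Type} (c : Code P) (T : P → (P → A) → Prop) : Prop :=
  (∀ f, c.con f → ∀ s, (T f s ↔ ∀ g s', c.ch f g → (∀ i j, c.mt f i j → s i = s' j) → ¬ T g s')) ∧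
  ∀ f s, c.rt f → T f s

/-- `A` carries a model of the code. -/
def Mod {P : Type} (c : Code P) (A : Type) : Prop := ∃ T : P → (P → A) → Prop, TClause c T

theorem Mod.congr {P A B : Type} {c : Code P} (e : A ≃ B) (h : Mod c A) : Mod c B := by
  obtain ⟨T, h1, h2⟩ := h
  refine ⟨fun f s => T f (fun i => e.symm (s i)), fun f hf s => ?_, fun f s hf => h2 _ _ hf⟩
  beta_reduce
  rw [h1 f hf]
  constructor
  · intro h g s' hg hm
    exact h g _ hg fun i j hij => by rw [hm i j hij]
  · intro h g s' hg hm
    have := h g (fun i => e (s' i)) hg fun i j hij => by rw [← hm i j hij]; simp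
    simpa using this

/-- Transport of codes. -/
def Code.map {P Q : Type} (e : P ≃ Q) (c : Code P) : Code Q where
  con f := c.con (e.symm f)
  ch f g := c.ch (e.symm f) (e.symm g)
  mt f i j := c.mt (e.symm f) (e.symm i) (e.symm j)
  rt f := c.rt (e.symm f)

theorem Mod.map {P Q A : Type} {c : Code P} (e : P ≃ Q) (h : Mod c A) : Mod (c.map e) A := by
  obtain ⟨T, h1, h2⟩ := h
  refine ⟨fun f s => T (e.symm f) (fun i => s (e i)), fun f hf s => ?_, fun f s hf => h2 _ _ hf⟩
  beta_reduce
  rw [h1 _ hf]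
  constructor
  · intro h g s' hg hm
    refine h (e.symm g) _ hg fun i j hij => hm _ _ ?_
    simpa [Code.map] using hij
  · intro h g s' hg hm
    have := h (e g) (fun i => s' (e.symm i)) (by simpa [Code.map] using hg) fun i j hij => by
      have := hm _ _ hij
      simpa using this
    simpa using this

theorem Code.map_symm_map {P Q : Type} (e : P ≃ Q) (c : Code P) : (c.map e).map e.symm = c := by
  simp [Code.map]

theorem mod_map_iff {P Q A : Type} {c : Code P} (e : P ≃ Q) : Mod (c.map e) A ↔ Mod c A := by
  refine ⟨fun h => ?_, fun h => h.map e⟩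
  have := h.map e.symm
  rwa [Code.map_symm_map] at this

/-- Downward Löwenheim–Skolem for codes. -/
theorem Mod.down {P A B : Type} {c : Code P} (hA : Mod c A) (hB : ℵ₀ ≤ #B) (hPB : #P ≤ #B)
    (hpow : #B ^ #P ≤ #B) (hBA : #B ≤ #A) : Mod c B := by
  classical
  obtain ⟨T, h1, h2⟩ := hA
  have hw : ∀ f (s : P → A), ∃ s' : P → A, c.con f → ¬ T f s →
      ∃ g, c.ch f g ∧ (∀ i j, c.mt f i j → s i = s' j) ∧ T g s' := by
    intro f s
    by_cases h : c.con f ∧ ¬ T f s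
    · have h3 := h.2
      rw [h1 f h.1] at h3
      push Not at h3
      obtain ⟨g, s', h4, h5, h6⟩ := h3
      exact ⟨s', fun _ _ => ⟨g, h4, h5, h6⟩⟩
    · exact ⟨s, fun h3 h4 => (h ⟨h3, h4⟩).elim⟩
  choose w hw using hw
  obtain ⟨j⟩ := Cardinal.le_def _ _ |>.1 hBA
  let β : B ⊕ (P × P) → Type := Sum.elim (fun _ => Empty) (fun _ => P)
  let ev : WType β → A := fun t => WType.elim A (fun x : Σ a : B ⊕ (P × P), β a → A =>
    match x with
    | ⟨Sum.inl b, _⟩ => j b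
    | ⟨Sum.inr p, u⟩ => w p.1 u p.2) t
  let A' : Set A := Set.range ev
  have hle : #A' ≤ #B := by
    refine Cardinal.mk_range_le.trans (WType.cardinalMk_le_of_le ?_)
    have hb : ∀ a, #B ^ #(β a) ≤ #B := by
      rintro (a | a)
      · simp only [β, Sum.elim_inl, Cardinal.mk_eq_zero, Cardinal.power_zero]
        exact Cardinal.one_le_aleph0.trans hB
      · exact hpow
    refine (Cardinal.sum_le_sum _ (fun _ => #B) hb).trans ?_
    rw [Cardinal.sum_const']
    refine Cardinal.mul_le_of_le hB ?_ le_rfl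
    rw [Cardinal.mk_sum, Cardinal.lift_id, Cardinal.lift_id]
    refine Cardinal.add_le_of_le hB le_rfl ?_
    rw [Cardinal.mk_prod, Cardinal.lift_id]
    exact Cardinal.mul_le_of_le hB hPB hPB
  have hge : #B ≤ #A' := by
    refine Cardinal.mk_le_of_injective (f := fun b => ⟨j b, ⟨⟨Sum.inl b, Empty.elim⟩, rfl⟩⟩) ?_
    intro a b hab
    exact j.injective (Subtype.mk.inj hab)
  obtain ⟨e⟩ := Cardinal.eq.1 (le_antisymm hle hge)
  have hcl : ∀ f (s : P → A') i, w f (fun k => (s k : A)) i ∈ A' := by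
    intro f s i
    choose u hu using fun k => (s k).2
    refine ⟨⟨Sum.inr (f, i), u⟩, ?_⟩
    have : (fun k => (s k : A)) = fun k => ev (u k) := funext fun k => (hu k).symm
    rw [this]
    rfl
  refine Mod.congr e ⟨fun f s => T f (fun k => (s k : A)), fun f hf s => ?_,
    fun f s hf => h2 _ _ hf⟩
  constructor
  · intro h g s' hg hm
    exact (h1 f hf _).1 h g _ hg fun i j hij => congrArg _ (hm i j hij)
  · intro h
    by_contra hT
    obtain ⟨g, h3, h4, h5⟩ := hw f _ hf hT
    exact h g (fun i => ⟨_, hcl f s i⟩) h3 (fun i j hij => Subtype.ext (h4 i j hij)) h5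

/-! ### An infinitary logic with infinite strings of quantifiers, and its coding -/

/-- Infinitary formulas: free relations on sequences, and joint denials. -/
inductive XF (Sy I : Type) : Type 1
  | free : Sy → XF Sy I
  | nor : (ι : Type) → (I → I → Prop) → (ι → XF Sy I) → XF Sy I

/-- Satisfaction. -/
def XEval {Sy I A : Type} (r : Sy → (I → A) → Prop) : XF Sy I → (I → A) → Prop
  | .free k, s => r k s
  | .nor _ m f, s => ∀ i s', (∀ a b, m a b → s a = s' b) → ¬ XEval r (f i) s'

/-- Subformulas. -/
def XF.subs {Sy I : Type} : XF Sy I → Set (XF Sy I)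
  | .free k => {.free k}
  | .nor ι m f => {.nor ι m f} ∪ ⋃ i, (f i).subs

/-- Hereditary size bound. -/
def XF.HB {Sy I : Type} (K : Type) : XF Sy I → Prop
  | .free _ => True
  | .nor ι _ f => Nonempty (ι ↪ K) ∧ ∀ i, (f i).HB K

theorem XF.self_mem_subs {Sy I : Type} (x : XF Sy I) : x ∈ x.subs := by
  cases x with
  | free k => exact rfl
  | nor ι m f => exact Or.inl rfl

theorem XF.enum_subs {Sy I K : Type} [Infinite K] (x : XF Sy I) (h : x.HB K) :
    Enum K x.subs := by
  induction x with
  | free k => exact Enum.singleton _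
  | nor ι m f ih => exact (Enum.singleton _).union (Enum.iUnion h.1 fun i => ih i (h.2 i))

theorem XF.child_mem_subs {Sy I : Type} (x : XF Sy I) {ι : Type} {m : I → I → Prop}
    {f : ι → XF Sy I} (h : XF.nor ι m f ∈ x.subs) (i : ι) : f i ∈ x.subs := by
  induction x with
  | free k => cases h
  | nor ι' m' f' ih =>
    rcases h with h | h
    · cases h
      exact Or.inr (Set.mem_iUnion.2 ⟨i, XF.self_mem_subs _⟩)
    · obtain ⟨j, hj⟩ := Set.mem_iUnion.1 h
      exact Or.inr (Set.mem_iUnion.2 ⟨j, ih j hj⟩)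

theorem exists_code {Sy P : Type} [Infinite P] (x : XF Sy P) (hx : x.HB P) :
    ∃ c : Code P, ∀ A : Type, Mod c A ↔ ∃ r : Sy → (P → A) → Prop, ∀ s, XEval r x s := by
  classical
  obtain ⟨e, he⟩ := (x.enum_subs hx).injOn
  refine ⟨{ con := fun p => ∃ ι m f, XF.nor ι m f ∈ x.subs ∧ p = e (XF.nor ι m f)
            ch := fun p q => ∃ ι m f i, XF.nor ι m f ∈ x.subs ∧ p = e (XF.nor ι m f) ∧ q = e (f i)
            mt := fun p a b => ∃ ι m f, XF.nor ι m f ∈ x.subs ∧ p = e (XF.nor ι m f) ∧ m a b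
            rt := fun p => p = e x }, fun A => ⟨?_, ?_⟩⟩
  · rintro ⟨T, h1, h2⟩
    refine ⟨fun k s => T (e (.free k)) s, fun s => ?_⟩
    have key : ∀ y : XF Sy P, y ∈ x.subs → ∀ s,
        (XEval (fun k s => T (e (.free k)) s) y s ↔ T (e y) s) := by
      intro y
      induction y with
      | free k => intro _ s; exact Iff.rfl
      | nor ι m f ih =>
        intro hy s
        rw [h1 _ ⟨ι, m, f, hy, rfl⟩ s]
        simp only [XEval]
        constructor
        · rintro h g s' ⟨ι', m', f', i, hy', hee, rfl⟩ hm
          cases he hy hy' hee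
          have h3 := h i s' fun a b hab => hm a b ⟨ι, m, f, hy, rfl, hab⟩
          rwa [ih i (x.child_mem_subs hy i)] at h3
        · intro h i s' hm
          rw [ih i (x.child_mem_subs hy i)]
          refine h _ s' ⟨ι, m, f, i, hy, rfl, rfl⟩ ?_
          rintro a b ⟨ι', m', f', hy', hee, hab⟩
          cases he hy hy' hee
          exact hm a b hab
    exact (key x x.self_mem_subs s).2 (h2 _ s rfl)
  · rintro ⟨r, hr⟩
    have hT : ∀ y ∈ x.subs, ∀ s, (∃ y' ∈ x.subs, e y = e y' ∧ XEval r y' s) ↔ XEval r y s := by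
      intro y hy s
      constructor
      · rintro ⟨y', hy', hee, h⟩
        cases he hy hy' hee
        exact h
      · intro h
        exact ⟨y, hy, rfl, h⟩
    refine ⟨fun p s => ∃ y ∈ x.subs, p = e y ∧ XEval r y s, ?_, ?_⟩
    · rintro _ ⟨ι, m, f, hy, rfl⟩ s
      beta_reduce
      rw [hT _ hy]
      simp only [XEval]
      constructor
      · rintro h g s' ⟨ι', m', f', i, hy', hee, rfl⟩ hm
        cases he hy hy' hee
        rw [hT _ (x.child_mem_subs hy i)]
        exact h i s' fun a b hab => hm a b ⟨ι, m, f, hy, rfl, hab⟩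
      · intro h i s' hm
        have h3 := h _ s' ⟨ι, m, f, i, hy, rfl, rfl⟩ (by
          rintro a b ⟨ι', m', f', hy', hee, hab⟩
          cases he hy hy' hee
          exact hm a b hab)
        rwa [hT _ (x.child_mem_subs hy i)] at h3
    · rintro _ s rfl
      exact ⟨x, x.self_mem_subs, rfl, hr s⟩

/-! ### Derived connectives -/

section Derived
variable {Sy I A : Type}

def XF.not (g : XF Sy I) : XF Sy I := .nor Unit Eq fun _ => g
def XF.conj (ι : Type) (f : ι → XF Sy I) : XF Sy I := .nor ι Eq fun i => (f i).not
def XF.all (m : I → I → Prop) (g : XF Sy I) : XF Sy I := .nor Unit m fun _ => g.not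
def XF.ex (m : I → I → Prop) (g : XF Sy I) : XF Sy I := XF.not (.nor Unit m fun _ => g)
def XF.and (f g : XF Sy I) : XF Sy I := XF.conj Bool fun b => cond b f g
def XF.top : XF Sy I := XF.conj Empty Empty.elim
def XF.eqs (a b : I) : XF Sy I := XF.ex (fun i j => (i = a ∨ i = b) ∧ j = a) XF.top
def XF.dis (ι : Type) (f : ι → XF Sy I) : XF Sy I := XF.not (XF.conj ι fun i => (f i).not)
def XF.imp (f g : XF Sy I) : XF Sy I := XF.not (XF.and f g.not)

variable (r : Sy → (I → A) → Prop)

theorem match_eq (s s' : I → A) : (∀ a b, a = b → s a = s' b) ↔ s' = s :=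
  ⟨fun h => funext fun a => (h a a rfl).symm, by rintro rfl a b rfl; rfl⟩

@[simp] theorem xeval_not (g : XF Sy I) (s : I → A) : XEval r g.not s ↔ ¬ XEval r g s := by
  simp only [XF.not, XEval, match_eq]
  simp

@[simp] theorem xeval_conj (ι : Type) (f : ι → XF Sy I) (s : I → A) :
    XEval r (XF.conj ι f) s ↔ ∀ i, XEval r (f i) s := by
  simp only [XF.conj, XEval, match_eq]
  simp

@[simp] theorem xeval_all (m : I → I → Prop) (g : XF Sy I) (s : I → A) :
    XEval r (XF.all m g) s ↔ ∀ s' : I → A, (∀ a b, m a b → s a = s' b) → XEval r g s' := by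
  simp only [XF.all, XEval, xeval_not]
  simp

@[simp] theorem xeval_ex (m : I → I → Prop) (g : XF Sy I) (s : I → A) :
    XEval r (XF.ex m g) s ↔ ∃ s' : I → A, (∀ a b, m a b → s a = s' b) ∧ XEval r g s' := by
  simp only [XF.ex, XEval, xeval_not]
  simp

@[simp] theorem xeval_and (f g : XF Sy I) (s : I → A) :
    XEval r (XF.and f g) s ↔ XEval r f s ∧ XEval r g s := by
  simp [XF.and, and_comm]

@[simp] theorem xeval_top (s : I → A) : XEval r (XF.top : XF Sy I) s := by
  simp [XF.top]

@[simp] theorem xeval_dis (ι : Type) (f : ι → XF Sy I) (s : I → A) :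
    XEval r (XF.dis ι f) s ↔ ∃ i, XEval r (f i) s := by
  simp [XF.dis]

@[simp] theorem xeval_imp (f g : XF Sy I) (s : I → A) :
    XEval r (XF.imp f g) s ↔ (XEval r f s → XEval r g s) := by
  simp [XF.imp]

@[simp] theorem xeval_eqs (a b : I) (s : I → A) :
    XEval r (XF.eqs a b) s ↔ s a = s b := by
  simp only [XF.eqs, xeval_ex, xeval_top, and_true]
  constructor
  · rintro ⟨s', h⟩
    rw [h a a ⟨Or.inl rfl, rfl⟩, h b a ⟨Or.inr rfl, rfl⟩]
  · intro h
    refine ⟨fun _ => s a, ?_⟩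
    rintro i j ⟨rfl | rfl, rfl⟩
    · rfl
    · exact h.symm

variable {K : Type} [Infinite K]

theorem HB_not {g : XF Sy I} (h : g.HB K) : g.not.HB K := ⟨emb_of_finite _, fun _ => h⟩
theorem HB_conj {ι : Type} {f : ι → XF Sy I} (hι : Nonempty (ι ↪ K)) (h : ∀ i, (f i).HB K) :
    (XF.conj ι f).HB K := ⟨hι, fun i => HB_not (h i)⟩
theorem HB_all {m : I → I → Prop} {g : XF Sy I} (h : g.HB K) : (XF.all m g).HB K :=
  ⟨emb_of_finite _, fun _ => HB_not h⟩
theorem HB_ex {m : I → I → Prop} {g : XF Sy I} (h : g.HB K) : (XF.ex m g).HB K :=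
  HB_not ⟨emb_of_finite _, fun _ => h⟩
theorem HB_and {f g : XF Sy I} (hf : f.HB K) (hg : g.HB K) : (XF.and f g).HB K :=
  HB_conj (emb_of_finite _) (by rintro (_ | _); exacts [hg, hf])
theorem HB_top : (XF.top : XF Sy I).HB K := HB_conj (emb_of_finite _) (fun i => i.elim)
theorem HB_eqs {a b : I} : (XF.eqs a b : XF Sy I).HB K := HB_ex HB_top
theorem HB_dis {ι : Type} {f : ι → XF Sy I} (hι : Nonempty (ι ↪ K)) (h : ∀ i, (f i).HB K) :
    (XF.dis ι f).HB K := HB_not (HB_conj hι fun i => HB_not (h i))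
theorem HB_imp {f g : XF Sy I} (hf : f.HB K) (hg : g.HB K) : (XF.imp f g).HB K :=
  HB_not (HB_and hf (HB_not hg))

end Derived

/-! ### Translation of `L^c` -/

section Translate
variable {I : Type} (σ : ℕ × ℕ × ℕ → I)

/-- Slots: first order variables, arguments, value, spare, and enumerations of set variables. -/
def slv (x : ℕ) : I := σ (0, x, 0)
def sly (k : ℕ) : I := σ (1, k, 0)
def slz : I := σ (2, 0, 0)
def slc : I := σ (3, 0, 0)
def slw (X k : ℕ) : I := σ (4, X, k)
def slu (X k : ℕ) : I := σ (5, X, k)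

def cloF {n : ℕ} (f : L.Functions n) : XF L.Symbols I :=
  XF.all (fun i j => (∃ k : Fin n, i = sly σ k ∧ j = sly σ k) ∨ (i = slz σ ∧ j = slz σ))
    (.free (Sum.inl ⟨n, f⟩))

def cloR {n : ℕ} (R : L.Relations n) : XF L.Symbols I :=
  XF.all (fun i j => ∃ k : Fin n, i = sly σ k ∧ j = sly σ k) (.free (Sum.inr ⟨n, R⟩))

def keepV (i j : I) : Prop := ∃ x, i = slv σ x ∧ j = slv σ x

/-- `t = z`. -/
def tm : L.Term ℕ → XF L.Symbols I
  | .var x => XF.eqs (slv σ x) (slz σ)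
  | .func (l := n) f ts => XF.ex (fun i j => keepV σ i j ∨ (i = slz σ ∧ j = slz σ))
      (XF.and (XF.conj (Fin n) fun k =>
        XF.ex (fun i j => keepV σ i j ∨ (i = sly σ k ∧ j = slz σ)) (tm (ts k))) (cloF σ f))

def tr : Fml L → XF L.Symbols I
  | .rel (n := n) R ts => XF.ex (keepV σ)
      (XF.and (XF.conj (Fin n) fun k =>
        XF.ex (fun i j => keepV σ i j ∨ (i = sly σ k ∧ j = slz σ)) (tm σ (ts k))) (cloR σ R))
  | .eq t₁ t₂ => XF.ex (keepV σ) (XF.and (tm σ t₁) (tm σ t₂))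
  | .mem X t => XF.ex (fun i j => i = j ∧ i ≠ slz σ) (XF.and (tm σ t)
      (XF.dis ℕ fun k => XF.and (XF.eqs (slw σ X k) (slz σ))
        (XF.not (XF.eqs (slw σ X k) (slu σ X k)))))
  | .not φ => (tr φ).not
  | .conj ι f => XF.conj ι fun i => tr (f i)
  | .all x φ => XF.all (fun i j => i = j ∧ i ≠ slv σ x) (tr φ)
  | .qC X φ => XF.ex (fun i j => i = j ∧ ∀ k, i ≠ slw σ X k ∧ i ≠ slu σ X k) (tr φ)
  | _ => XF.top.not

def axF {n : ℕ} (f : L.Functions n) : XF L.Symbols I :=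
  XF.all (fun _ _ => False) (XF.ex (fun i j => ∃ k : Fin n, i = sly σ k ∧ j = sly σ k)
    (XF.and (cloF σ f) (XF.all (fun i j => (∃ k : Fin n, i = sly σ k ∧ j = sly σ k) ∨
      (i = slz σ ∧ j = slc σ)) (XF.imp (cloF σ f) (XF.eqs (slc σ) (slz σ))))))

variable {A : Type} (r : L.Symbols → (I → A) → Prop)

theorem xeval_cloF {n : ℕ} (f : L.Functions n) (s : I → A) : XEval r (cloF σ f) s ↔
    ∀ s' : I → A, (∀ k : Fin n, s (sly σ k) = s' (sly σ k)) → s (slz σ) = s' (slz σ) →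
      r (Sum.inl ⟨n, f⟩) s' := by
  simp only [cloF, xeval_all, XEval]
  constructor
  · intro h s' h1 h2
    apply h
    rintro a b (⟨k, rfl, rfl⟩ | ⟨rfl, rfl⟩)
    exacts [h1 k, h2]
  · intro h s' h1
    exact h s' (fun k => h1 _ _ (Or.inl ⟨k, rfl, rfl⟩)) (h1 _ _ (Or.inr ⟨rfl, rfl⟩))

theorem xeval_cloR {n : ℕ} (R : L.Relations n) (s : I → A) : XEval r (cloR σ R) s ↔
    ∀ s' : I → A, (∀ k : Fin n, s (sly σ k) = s' (sly σ k)) → r (Sum.inr ⟨n, R⟩) s' := by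
  simp only [cloR, xeval_all, XEval]
  constructor
  · intro h s' h1
    apply h
    rintro a b ⟨k, rfl, rfl⟩
    exact h1 k
  · intro h s' h1
    exact h s' (fun k => h1 _ _ ⟨k, rfl, rfl⟩)

/-- Compatibility of a structure with an interpretation of the free relations. -/
def SymOK (S : L.Structure A) : L.Symbols → Prop
  | Sum.inl ⟨n, f⟩ => ∀ s : I → A, XEval r (cloF σ f) s ↔
      S.funMap f (fun k : Fin n => s (sly σ k)) = s (slz σ)
  | Sum.inr ⟨n, R⟩ => ∀ s : I → A, XEval r (cloR σ R) s ↔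
      S.RelMap R (fun k : Fin n => s (sly σ k))

/-- Change of arguments and value. -/
noncomputable def updY (s : I → A) {n : ℕ} (a : Fin n → A) (b : A) : I → A := by
  classical exact fun i =>
    if h : ∃ k : Fin n, i = sly σ k then a h.choose else if i = slz σ then b else s i

variable {σ} (hσ : Function.Injective σ)
include hσ

theorem updY_y (s : I → A) {n : ℕ} (a : Fin n → A) (b : A) (k : Fin n) :
    updY σ s a b (sly σ k) = a k := by
  have h : ∃ k' : Fin n, sly σ k = sly σ k' := ⟨k, rfl⟩
  simp only [updY, dif_pos h]
  congr 1
  have h1 := hσ h.choose_spec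
  simp only [Prod.mk.injEq, and_true, true_and] at h1
  exact (Fin.ext h1).symm

theorem updY_z (s : I → A) {n : ℕ} (a : Fin n → A) (b : A) :
    updY σ s a b (slz σ) = b := by
  have h : ¬ ∃ k' : Fin n, slz σ = sly σ k' := by
    rintro ⟨k, hk⟩
    have := hσ hk
    simp at this
  simp only [updY, dif_neg h, if_true]

theorem updY_v (s : I → A) {n : ℕ} (a : Fin n → A) (b : A) (x : ℕ) :
    updY σ s a b (slv σ x) = s (slv σ x) := by
  have h : ¬ ∃ k' : Fin n, slv σ x = sly σ k' := by
    rintro ⟨k, hk⟩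
    have := hσ hk
    simp at this
  have h' : slv σ x ≠ slz σ := fun hk => by
    have := hσ hk
    simp at this
  simp only [updY, dif_neg h, if_neg h']

variable {r}

omit hσ in
theorem exSub {n : ℕ} {S : L.Structure A} {t : L.Term ℕ} {k : Fin n}
    (hσ : Function.Injective σ)
    (ih : ∀ s, XEval r (tm σ t) s ↔ t.realize (fun x => s (slv σ x)) = s (slz σ)) (s : I → A) :
    XEval r (XF.ex (fun i j => keepV σ i j ∨ (i = sly σ k ∧ j = slz σ)) (tm σ t)) s ↔
      t.realize (fun x => s (slv σ x)) = s (sly σ k) := by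
  simp only [xeval_ex, ih]
  constructor
  · rintro ⟨s', h1, h2⟩
    rw [h1 _ _ (Or.inr ⟨rfl, rfl⟩), ← h2]
    congr 1
    funext x
    exact h1 _ _ (Or.inl ⟨x, rfl, rfl⟩)
  · intro h
    refine ⟨updY σ s (n := 0) Fin.elim0 (s (sly σ k)), ?_, ?_⟩
    · rintro a b (⟨x, rfl, rfl⟩ | ⟨rfl, rfl⟩)
      · rw [updY_v hσ]
      · rw [updY_z hσ]
    · rw [updY_z hσ]
      simp only [updY_v hσ]
      exact h

theorem xeval_tm {S : L.Structure A} (t : L.Term ℕ) (h : ∀ y ∈ tsym t, SymOK σ r S y) (s : I → A) :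
    XEval r (tm σ t) s ↔ t.realize (fun x => s (slv σ x)) = s (slz σ) := by
  induction t generalizing s with
  | var x => simp [tm]
  | @func n f ts ih =>
    have ih' : ∀ k s, XEval r (tm σ (ts k)) s ↔
        (ts k).realize (fun x => s (slv σ x)) = s (slz σ) := fun k s =>
      ih k (fun y hy => h y (Or.inr (Set.mem_iUnion.2 ⟨k, hy⟩))) s
    have hf := h (Sum.inl ⟨n, f⟩) (Or.inl rfl)
    simp only [SymOK] at hf
    rw [tm, xeval_ex]
    simp only [xeval_and, xeval_conj, exSub hσ (ih' _), hf]
    constructor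
    · rintro ⟨s', h1, h2, h3⟩
      have hv : (fun x => s (slv σ x)) = fun x => s' (slv σ x) :=
        funext fun x => h1 _ _ (Or.inl ⟨x, rfl, rfl⟩)
      rw [h1 _ _ (Or.inr ⟨rfl, rfl⟩), ← h3, hv]
      simp only [Language.Term.realize, h2]
    · intro h4
      refine ⟨updY σ s (fun k => (ts k).realize fun x => s (slv σ x)) (s (slz σ)), ?_, ?_, ?_⟩
      · rintro a b (⟨x, rfl, rfl⟩ | ⟨rfl, rfl⟩)
        · rw [updY_v hσ]
        · rw [updY_z hσ]
      · intro k
        rw [updY_y hσ]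
        simp only [updY_v hσ]
      · rw [updY_z hσ]
        simp only [updY_y hσ]
        exact h4

omit hσ in
variable (σ) in
/-- The value of set variables. -/
def vset (s : I → A) (X : ℕ) : Set A :=
  {a | ∃ k, s (slw σ X k) = a ∧ s (slw σ X k) ≠ s (slu σ X k)}

theorem xeval_tr [Nontrivial A] {S : L.Structure A} {κ : Cardinal} (φ : Fml L)
    (hφ : Ok (LcInf κ) φ)
    (h : ∀ y ∈ usym φ, SymOK σ r S y) (s : I → A) :
    XEval r (tr σ φ) s ↔
      @Eval L A S φ (fun x => s (slv σ x)) (vset σ s) (fun _ _ _ => False) := by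
  classical
  induction φ generalizing s with
  | @rel n R ts =>
    have ih' : ∀ k s, XEval r (tm σ (ts k)) s ↔
        (ts k).realize (fun x => s (slv σ x)) = s (slz σ) := fun k s =>
      xeval_tm hσ (ts k) (fun y hy => h y (Or.inr (Set.mem_iUnion.2 ⟨k, hy⟩))) s
    have hf := h (Sum.inr ⟨n, R⟩) (Or.inl rfl)
    simp only [SymOK] at hf
    rw [tr, xeval_ex]
    simp only [xeval_and, xeval_conj, exSub hσ (ih' _), hf, Eval]
    constructor
    · rintro ⟨s', h1, h2, h3⟩
      have hv : (fun x => s (slv σ x)) = fun x => s' (slv σ x) :=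
        funext fun x => h1 _ _ ⟨x, rfl, rfl⟩
      rw [hv]
      simp only [h2]
      exact h3
    · intro h4
      refine ⟨updY σ s (fun k => (ts k).realize fun x => s (slv σ x)) (s (slz σ)), ?_, ?_, ?_⟩
      · rintro a b ⟨x, rfl, rfl⟩
        rw [updY_v hσ]
      · intro k
        rw [updY_y hσ]
        simp only [updY_v hσ]
      · simp only [updY_y hσ]
        exact h4
  | eq t₁ t₂ =>
    simp only [tr, xeval_ex, xeval_and, Eval,
      xeval_tm hσ t₁ (fun y hy => h y (Or.inl hy)), xeval_tm hσ t₂ (fun y hy => h y (Or.inr hy))]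
    constructor
    · rintro ⟨s', h1, h2, h3⟩
      have hv : (fun x => s (slv σ x)) = fun x => s' (slv σ x) :=
        funext fun x => h1 _ _ ⟨x, rfl, rfl⟩
      rw [hv, h2, h3]
    · intro h4
      refine ⟨updY σ s (n := 0) Fin.elim0 (t₁.realize fun x => s (slv σ x)), ?_, ?_, ?_⟩
      · rintro a b ⟨x, rfl, rfl⟩
        rw [updY_v hσ]
      · rw [updY_z hσ]
        simp only [updY_v hσ]
      · rw [updY_z hσ]
        simp only [updY_v hσ]
        exact h4.symm
  | mem X t =>
    simp only [tr, xeval_ex, xeval_and, Eval, xeval_tm hσ t h, xeval_dis, xeval_eqs, xeval_not]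
    have hvz : ∀ x, slv σ x ≠ slz σ := fun x hk => by
      have := hσ hk
      simp at this
    have hwz : ∀ k, slw σ X k ≠ slz σ := fun x hk => by
      have := hσ hk
      simp at this
    have huz : ∀ k, slu σ X k ≠ slz σ := fun x hk => by
      have := hσ hk
      simp at this
    constructor
    · rintro ⟨s', h1, h2, k, h3, h4⟩
      have hv : (fun x => s (slv σ x)) = fun x => s' (slv σ x) :=
        funext fun x => h1 _ _ ⟨rfl, hvz x⟩
      rw [hv, h2]
      refine ⟨k, ?_, ?_⟩
      · rw [h1 _ _ ⟨rfl, hwz k⟩, h3]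
      · rw [h1 _ _ ⟨rfl, hwz k⟩, h1 _ _ ⟨rfl, huz k⟩]
        exact h4
    · rintro ⟨k, h3, h4⟩
      refine ⟨Function.update s (slz σ) (t.realize fun x => s (slv σ x)), ?_, ?_, k, ?_, ?_⟩
      · rintro a b ⟨rfl, hab⟩
        rw [Function.update_of_ne hab]
      · simp [Function.update_of_ne (hvz _)]
      · simp [Function.update_of_ne (hwz _), h3]
      · simpa [Function.update_of_ne (hwz _), Function.update_of_ne (huz _)] using h4
  | rmem X t₁ t₂ => simp [tr, Eval]
  | not φ ih => simp only [tr, xeval_not, Eval, ih hφ h]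
  | conj ι f ih =>
    simp only [tr, xeval_conj, Eval]
    exact forall_congr' fun i =>
      ih i (hφ.2 i) (fun y hy => h y (Set.mem_iUnion.2 ⟨i, hy⟩)) s
  | all x φ ih =>
    simp only [tr, xeval_all, Eval, ih hφ h]
    have hw : ∀ X k, slw σ X k ≠ slv σ x := fun X x hk => by
      have := hσ hk
      simp at this
    have hu : ∀ X k, slu σ X k ≠ slv σ x := fun X x hk => by
      have := hσ hk
      simp at this
    have key : ∀ s' : I → A, (∀ a b, a = b ∧ a ≠ slv σ x → s a = s' b) →
        (fun y => s' (slv σ y)) = Function.update (fun y => s (slv σ y)) x (s' (slv σ x)) ∧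
        vset σ s' = vset σ s := by
      intro s' hs'
      constructor
      · funext y
        by_cases hy : y = x
        · subst hy; simp
        · rw [Function.update_of_ne hy]
          refine (hs' _ _ ⟨rfl, fun hk => hy ?_⟩).symm
          have := hσ hk
          simpa using this
      · funext X
        simp only [vset, hs' _ _ ⟨rfl, hw _ _⟩, hs' _ _ ⟨rfl, hu _ _⟩]
    constructor
    · intro h1 a
      have h3 : ∀ i j, i = j ∧ i ≠ slv σ x → s i = Function.update s (slv σ x) a j := by
        rintro i j ⟨rfl, hij⟩
        rw [Function.update_of_ne hij]
      have h2 := h1 (Function.update s (slv σ x) a) h3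
      obtain ⟨h4, h5⟩ := key _ h3
      rw [h4, h5] at h2
      simpa using h2
    · intro h1 s' hs'
      obtain ⟨h4, h5⟩ := key _ hs'
      rw [h4, h5]
      exact h1 _
  | qC X φ ih =>
    simp only [tr, xeval_ex, Eval, ih hφ.2 h]
    have hv : ∀ x k, slv σ x ≠ slw σ X k ∧ slv σ x ≠ slu σ X k := fun x k =>
      ⟨fun hk => by have := hσ hk; simp at this, fun hk => by have := hσ hk; simp at this⟩
    have hw : ∀ Y, Y ≠ X → ∀ l k, slw σ Y l ≠ slw σ X k ∧ slw σ Y l ≠ slu σ X k := fun Y hY l k =>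
      ⟨fun hk => by have := hσ hk; simp [hY] at this, fun hk => by have := hσ hk; simp at this⟩
    have hu : ∀ Y, Y ≠ X → ∀ l k, slu σ Y l ≠ slw σ X k ∧ slu σ Y l ≠ slu σ X k := fun Y hY l k =>
      ⟨fun hk => by have := hσ hk; simp at this, fun hk => by have := hσ hk; simp [hY] at this⟩
    have key : ∀ s' : I → A,
        (∀ a b, (a = b ∧ ∀ k, a ≠ slw σ X k ∧ a ≠ slu σ X k) → s a = s' b) →
        (fun y => s' (slv σ y)) = (fun y => s (slv σ y)) ∧
        vset σ s' = Function.update (vset σ s) X (vset σ s' X) := by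
      intro s' hs'
      constructor
      · funext y
        exact (hs' _ _ ⟨rfl, hv y⟩).symm
      · funext Y
        by_cases hY : Y = X
        · subst hY; simp
        · rw [Function.update_of_ne hY]
          simp only [vset, hs' _ _ ⟨rfl, hw Y hY _⟩, hs' _ _ ⟨rfl, hu Y hY _⟩]
    constructor
    · rintro ⟨s', hs', h1⟩
      obtain ⟨h4, h5⟩ := key _ hs'
      rw [h4, h5] at h1
      refine ⟨_, ?_, h1⟩
      refine (Set.countable_range fun k => s' (slw σ X k)).mono ?_
      rintro a ⟨k, rfl, -⟩
      exact ⟨k, rfl⟩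
    · rintro ⟨D, hD, h1⟩
      obtain ⟨p, q, hpq⟩ : ∃ p q : ℕ → A, {a | ∃ k, p k = a ∧ p k ≠ q k} = D := by
        rcases D.eq_empty_or_nonempty with rfl | hne
        · obtain ⟨a⟩ : Nonempty A := inferInstance
          exact ⟨fun _ => a, fun _ => a, by simp⟩
        · obtain ⟨e, rfl⟩ := hD.exists_eq_range hne
          choose d hd using fun a : A => exists_ne a
          refine ⟨e, fun k => d (e k), ?_⟩
          ext a
          simp [(hd _).symm]
      let s' : I → A := fun i => if hi : ∃ k, i = slw σ X k then p hi.choose else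
        if hi : ∃ k, i = slu σ X k then q hi.choose else s i
      have hs' : ∀ a b, (a = b ∧ ∀ k, a ≠ slw σ X k ∧ a ≠ slu σ X k) → s a = s' b := by
        rintro a b ⟨rfl, hab⟩
        have h2 : ¬ ∃ k, a = slw σ X k := fun ⟨k, hk⟩ => (hab k).1 hk
        have h3 : ¬ ∃ k, a = slu σ X k := fun ⟨k, hk⟩ => (hab k).2 hk
        simp only [s', dif_neg h2, dif_neg h3]
      have hp : ∀ k, s' (slw σ X k) = p k := by
        intro k
        have h2 : ∃ l, slw σ X k = slw σ X l := ⟨k, rfl⟩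
        simp only [s', dif_pos h2]
        congr 1
        have := hσ h2.choose_spec
        simp only [Prod.mk.injEq, true_and] at this
        exact this.symm
      have hq : ∀ k, s' (slu σ X k) = q k := by
        intro k
        have h3 : ¬ ∃ l, slu σ X k = slw σ X l := fun ⟨l, hl⟩ => by
          have := hσ hl
          simp at this
        have h2 : ∃ l, slu σ X k = slu σ X l := ⟨k, rfl⟩
        simp only [s', dif_neg h3, dif_pos h2]
        congr 1
        have := hσ h2.choose_spec
        simp only [Prod.mk.injEq, true_and] at this
        exact this.symm
      refine ⟨s', hs', ?_⟩
      obtain ⟨h4, h5⟩ := key _ hs'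
      have h6 : vset σ s' X = D := by
        simp only [vset, hp, hq]
        exact hpq
      rw [h4, h5, h6]
      exact h1
  | qII X φ ih => exact hφ.1.elim
  | qWo x y φ ih => exact hφ.1.elim
  | qAA X φ ih => exact hφ.1.elim
  | qCf x y φ ih => exact hφ.1.elim

end Translate
/-! ### Completion of the translation -/

section Complete
variable {I K A : Type} [Infinite K] (σ : ℕ × ℕ × ℕ → I)

theorem HB_cloF {n : ℕ} (f : L.Functions n) : (cloF σ f).HB K := HB_all trivial

theorem HB_cloR {n : ℕ} (R : L.Relations n) : (cloR σ R).HB K := HB_all trivial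

theorem HB_tm (t : L.Term ℕ) : (tm σ t).HB K := by
  induction t with
  | var x => exact HB_eqs
  | func f ts ih =>
    exact HB_ex (HB_and (HB_conj (emb_of_finite _) fun k => HB_ex (ih k)) (HB_cloF σ f))

theorem HB_axF {n : ℕ} (f : L.Functions n) : (axF σ f).HB K :=
  HB_all (HB_ex (HB_and (HB_cloF σ f) (HB_all (HB_imp (HB_cloF σ f) HB_eqs))))

theorem HB_tr {κ : Cardinal} (hκ : κ ≤ Order.succ #K) (φ : Fml L) (hφ : Ok (LcInf κ) φ) :
    (tr σ φ).HB K := by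
  induction φ with
  | rel R ts =>
    exact HB_ex (HB_and (HB_conj (emb_of_finite _) fun k => HB_ex (HB_tm σ _)) (HB_cloR σ R))
  | eq t₁ t₂ => exact HB_ex (HB_and (HB_tm σ _) (HB_tm σ _))
  | mem X t =>
    exact HB_ex (HB_and (HB_tm σ _) (HB_dis ⟨Infinite.natEmbedding K⟩ fun k =>
      HB_and HB_eqs (HB_not HB_eqs)))
  | rmem X t₁ t₂ => exact HB_not HB_top
  | not φ ih => exact HB_not (ih hφ)
  | conj ι f ih => exact HB_conj (emb_of_lt hφ.1 hκ) fun i => ih i (hφ.2 i)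
  | all x φ ih => exact HB_all (ih hφ)
  | qWo x y φ ih => exact hφ.1.elim
  | qC X φ ih => exact HB_ex (ih hφ.2)
  | qAA X φ ih => exact hφ.1.elim
  | qII X φ ih => exact hφ.1.elim
  | qCf x y φ ih => exact hφ.1.elim

end Complete

/-- Satisfaction depends only on the free second order variables. -/
theorem eval_coincide {M : Type} [L.Structure M] {κ : Cardinal} (φ : Fml L)
    (hφ : Ok (LcInf κ) φ) (va : ℕ → M) (vs vs' : ℕ → Set M) (vr vr' : ℕ → M → M → Prop)
    (hs : ∀ X ∈ sv φ, vs X = vs' X) (hr : ∀ X ∈ rv φ, vr X = vr' X) :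
    Eval φ va vs vr ↔ Eval φ va vs' vr' := by
  induction φ generalizing va vs vs' with
  | rel R ts => rfl
  | eq t₁ t₂ => rfl
  | mem X t => simp only [Eval, hs X rfl]
  | rmem X t₁ t₂ => simp only [Eval, hr X rfl]
  | not φ ih => exact not_congr (ih hφ va vs vs' hs hr)
  | conj ι f ih =>
    exact forall_congr' fun i => ih i (hφ.2 i) va vs vs'
      (fun X hX => hs X (Set.mem_iUnion.2 ⟨i, hX⟩)) (fun X hX => hr X (Set.mem_iUnion.2 ⟨i, hX⟩))
  | all x φ ih => exact forall_congr' fun a => ih hφ _ vs vs' hs hr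
  | qWo x y φ ih => exact hφ.1.elim
  | qC X φ ih =>
    refine exists_congr fun D => and_congr_right fun _ => ih hφ.2 _ _ _ ?_ hr
    intro Y hY
    by_cases h : Y = X
    · subst h; simp
    · simp only [Function.update_of_ne h]
      exact hs Y ⟨hY, h⟩
  | qAA X φ ih => exact hφ.1.elim
  | qII X φ ih => exact hφ.1.elim
  | qCf x y φ ih => exact hφ.1.elim

section ToStruct
variable {I A : Type} {σ : ℕ × ℕ × ℕ → I} (hσ : Function.Injective σ)

theorem xeval_axF (r : L.Symbols → (I → A) → Prop) {n : ℕ} (f : L.Functions n) (s : I → A)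
    (hσ : Function.Injective σ) :
    XEval r (axF σ f) s ↔ ∀ a : Fin n → A, ∃! b, ∀ s'' : I → A,
      (∀ k, a k = s'' (sly σ k)) → b = s'' (slz σ) → r (Sum.inl ⟨n, f⟩) s'' := by
  classical
  have hcy : ∀ k : ℕ, sly σ k ≠ slc σ := fun k hk => by
    have := hσ hk
    simp at this
  have hcz : slz σ ≠ slc σ := fun hk => by
    have := hσ hk
    simp at this
  simp only [axF, xeval_all, xeval_ex, xeval_and, xeval_imp, xeval_eqs, xeval_cloF]
  constructor
  · intro h a
    obtain ⟨s', h1, h2, h3⟩ := h (updY σ s a (s (slz σ))) (by simp)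
    have hy : ∀ k : Fin n, a k = s' (sly σ k) := fun k => by
      rw [← h1 _ _ ⟨k, rfl, rfl⟩, updY_y hσ]
    refine ⟨s' (slz σ), ?_, ?_⟩
    · intro s'' h4 h5
      exact h2 s'' (fun k => by rw [← hy, h4]) h5
    · intro b hb
      have := h3 (Function.update (updY σ s a b) (slc σ) (s' (slz σ))) ?_ ?_
      · rw [Function.update_self, Function.update_of_ne hcz, updY_z hσ] at this
        exact this.symm
      · rintro i j (⟨k, rfl, rfl⟩ | ⟨rfl, rfl⟩)
        · rw [Function.update_of_ne (hcy _), updY_y hσ, hy]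
        · rw [Function.update_self]
      · intro s'' h4 h5
        rw [Function.update_of_ne hcz, updY_z hσ] at h5
        refine hb s'' (fun k => ?_) h5
        rw [← h4 k, Function.update_of_ne (hcy _), updY_y hσ]
  · intro h s1 _
    obtain ⟨b, hb, hu⟩ := h fun k => s1 (sly σ k)
    refine ⟨updY σ s1 (fun k : Fin n => s1 (sly σ k)) b, ?_, ?_, ?_⟩
    · rintro i j ⟨k, rfl, rfl⟩
      rw [updY_y hσ]
    · intro s'' h4 h5
      rw [updY_z hσ] at h5
      exact hb s'' (fun k => by rw [← h4, updY_y hσ]) h5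
    · intro s2 h4 h5
      have h6 := hu (s2 (slz σ)) fun s'' h7 h8 => h5 s'' (fun k => by
        rw [← h7, ← h4 _ _ (Or.inl ⟨k, rfl, rfl⟩), updY_y hσ]) h8
      rw [h6, ← h4 _ _ (Or.inr ⟨rfl, rfl⟩), updY_z hσ]

end ToStruct

theorem exists_code_fml {P : Type} [Infinite P] {κ : Cardinal} (hκ : κ ≤ Order.succ #P)
    (φ : Fml L) (hs : IsSentence φ) (hφ : Ok (LcInf κ) φ) :
    ∃ c : Code P, ∀ A : Type, Nontrivial A →
      (Mod c A ↔ ∃ S : L.Structure A, @Sat L A S φ) := by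
  classical
  obtain ⟨σ, hσ⟩ : ∃ σ : ℕ × ℕ × ℕ → P, Function.Injective σ :=
    ⟨_, ((Denumerable.eqv (ℕ × ℕ × ℕ)).toEmbedding.trans (Infinite.natEmbedding P)).injective⟩
  obtain ⟨g, hg⟩ := enum_usym (A := LcInf κ) hκ φ hφ
  let ax : Option L.Symbols → XF L.Symbols P := fun o => match o with
    | some (Sum.inl ⟨_, f⟩) => axF σ f
    | _ => XF.top
  have hax : ∀ o, (ax o).HB P := by
    rintro (_ | ⟨n, f⟩ | ⟨n, f⟩)
    exacts [HB_top, HB_axF σ f, HB_top]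
  obtain ⟨c, hc⟩ := exists_code (XF.and (tr σ φ) (XF.conj P fun i => ax (g i)))
    (HB_and (HB_tr σ hκ φ hφ) (HB_conj ⟨Function.Embedding.refl P⟩ fun i => hax _))
  refine ⟨c, fun A hA => ?_⟩
  rw [hc]
  simp only [xeval_and, xeval_conj]
  have fin : ∀ (S : L.Structure A) (r : L.Symbols → (P → A) → Prop),
      (∀ y ∈ usym φ, SymOK σ r S y) → ((∀ s, XEval r (tr σ φ) s) ↔ @Sat L A S φ) := by
    intro S r h
    constructor
    · intro h1 va vs vr
      have h2 : ∃ s : P → A, ∀ x, s (slv σ x) = va x := by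
        refine ⟨fun i => if h : ∃ x, i = slv σ x then va h.choose else va 0, fun x => ?_⟩
        have h : ∃ y, slv σ x = slv σ y := ⟨x, rfl⟩
        simp only [dif_pos h]
        congr 1
        have := hσ h.choose_spec
        simp only [Prod.mk.injEq, and_true, true_and] at this
        exact this.symm
      obtain ⟨s, hs1⟩ := h2
      have h3 := (xeval_tr hσ φ hφ h s).1 (h1 s)
      rw [funext hs1] at h3
      exact (eval_coincide φ hφ va _ vs _ vr (by simp [hs.2.1]) (by simp [hs.2.2])).1 h3
    · intro h1 s
      exact (xeval_tr hσ φ hφ h s).2 (h1 _ _ _)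
  constructor
  · rintro ⟨r, hr⟩
    obtain ⟨a0⟩ : Nonempty A := inferInstance
    have hex : ∀ n (f : L.Functions n), Sum.inl ⟨n, f⟩ ∈ usym φ → ∀ a : Fin n → A,
        ∃! b, ∀ s'' : P → A,
        (∀ k, a k = s'' (sly σ k)) → b = s'' (slz σ) → r (Sum.inl ⟨n, f⟩) s'' := by
      intro n f hf
      obtain ⟨k, hk⟩ := hg _ hf
      have := (hr (fun _ => a0)).2 k
      rw [hk] at this
      exact (xeval_axF r f _ hσ).1 this
    let S : L.Structure A :=
      { funMap := fun {n} f a => if h : ∃! b, ∀ s'' : P → A,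
          (∀ k, a k = s'' (sly σ k)) → b = s'' (slz σ) → r (Sum.inl ⟨n, f⟩) s''
          then h.choose else a0
        RelMap := fun {n} R a => ∀ s'' : P → A,
          (∀ k, a k = s'' (sly σ k)) → r (Sum.inr ⟨n, R⟩) s'' }
    refine ⟨S, (fin S r ?_).1 fun s => (hr s).1⟩
    rintro (⟨n, f⟩ | ⟨n, R⟩) hy s
    · rw [xeval_cloF]
      have h1 := hex n f hy fun k => s (sly σ k)
      have h2 : S.funMap f (fun k : Fin n => s (sly σ k)) = h1.choose := dif_pos h1
      rw [h2]
      have h3 := h1.choose_spec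
      constructor
      · intro h4
        exact (h3.2 (s (slz σ)) h4).symm
      · intro h4 s' h5 h6
        exact h3.1 s' h5 (h4.trans h6)
    · rw [xeval_cloR]
      exact Iff.rfl
  · rintro ⟨S, hS⟩
    let r : L.Symbols → (P → A) → Prop := fun y s => match y with
      | Sum.inl ⟨n, f⟩ => S.funMap f (fun k : Fin n => s (sly σ k)) = s (slz σ)
      | Sum.inr ⟨n, R⟩ => S.RelMap R (fun k : Fin n => s (sly σ k))
    refine ⟨r, fun s => ⟨(fin S r ?_).2 hS s, fun i => ?_⟩⟩
    · rintro (⟨n, f⟩ | ⟨n, R⟩) hy s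
      · rw [xeval_cloF]
        constructor
        · intro h
          exact h s (fun _ => rfl) rfl
        · intro h s' h1 h2
          simp only [r]
          rw [← h2, ← h]
          simp only [h1]
      · rw [xeval_cloR]
        constructor
        · intro h
          exact h s (fun _ => rfl)
        · intro h s' h1
          simp only [r]
          simpa only [← h1] using h
    · rcases g i with _ | ⟨n, f⟩ | ⟨n, R⟩
      · exact xeval_top r s
      · refine (xeval_axF r f s hσ).2 fun a => ⟨S.funMap f a, ?_, ?_⟩
        · intro s'' h1 h2
          simp only [r]
          rw [← h2]
          simp only [← h1]
        · intro b hb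
          have := hb (updY σ s a b) (fun k => by rw [updY_y hσ]) (by rw [updY_z hσ])
          simp only [r, updY_y hσ, updY_z hσ] at this
          exact this.symm
      · exact xeval_top r s
/-! ### The second order sentence -/

/-- Extra function symbols. -/
inductive XFn : ℕ → Type
  | rho : XFn 1
  | val : XFn 2

/-- Extra relation symbols. -/
inductive XRl : ℕ → Type
  | N : XRl 1
  | E : XRl 2
  | Lt : XRl 2
  | D : XRl 2
  | T : XRl 3
  | Con : XRl 2
  | Ch : XRl 3
  | Mt : XRl 4
  | Rt : XRl 2

/-- The expanded language. -/
def LX (L : FirstOrder.Language.{0,0}) : FirstOrder.Language.{0,0} :=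
  ⟨fun n => L.Functions n ⊕ XFn n, fun n => L.Relations n ⊕ XRl n⟩

/-- The interpretation of the extra symbols. -/
structure Sys (M : Type) where
  rho : M → M
  val : M → M → M
  N : M → Prop
  E : M → M → Prop
  Lt : M → M → Prop
  D : M → M → Prop
  T : M → M → M → Prop
  Con : M → M → Prop
  Ch : M → M → M → Prop
  Mt : M → M → M → M → Prop
  Rt : M → M → Prop

def fnX {n : ℕ} (f : XFn n) : (LX L).Functions n := Sum.inr f
def rlX {n : ℕ} (R : XRl n) : (LX L).Relations n := Sum.inr R

/-- The system of a structure. -/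
def sysOf {M : Type} (S : (LX L).Structure M) : Sys M where
  rho a := S.funMap (fnX .rho) ![a]
  val a b := S.funMap (fnX .val) ![a, b]
  N a := S.RelMap (rlX .N) ![a]
  E a b := S.RelMap (rlX .E) ![a, b]
  Lt a b := S.RelMap (rlX .Lt) ![a, b]
  D a b := S.RelMap (rlX .D) ![a, b]
  T a b c := S.RelMap (rlX .T) ![a, b, c]
  Con a b := S.RelMap (rlX .Con) ![a, b]
  Ch a b c := S.RelMap (rlX .Ch) ![a, b, c]
  Mt a b c d := S.RelMap (rlX .Mt) ![a, b, c, d]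
  Rt a b := S.RelMap (rlX .Rt) ![a, b]

/-- The truth clauses relative to a domain. -/
def Sys.Clause {M : Type} (X : Sys M) (n : M) (T : M → M → Prop) (Dm : M → Prop) : Prop :=
  (∀ f, X.Con n (X.rho f) → ∀ s, Dm s → (T (X.rho f) s ↔
    ∀ g s', Dm s' → X.Ch n (X.rho f) (X.rho g) →
      (∀ i j, X.Mt n (X.rho f) (X.rho i) (X.rho j) → X.val (X.rho i) s = X.val (X.rho j) s') →
      ¬ T (X.rho g) s')) ∧
  ∀ f s, X.Rt n (X.rho f) → Dm s → T (X.rho f) s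

structure Sys.Good {M : Type} (X : Sys M) : Prop where
  seq : ∀ R : M → M → Prop, ∃ m, ∀ p, (∃ x, R (X.rho p) x) → R (X.rho p) (X.val (X.rho p) m)
  ext : ∀ m m', (∀ x, (X.N x → (X.E x m ↔ X.E x m')) ∧
    (X.E (X.rho x) m ↔ X.E (X.rho x) m')) → m = m'
  tri : ∀ x y, X.N x → X.N y → x = y ∨ X.Lt x y ∨ X.Lt y x
  pos : ∀ n, X.N n → (∀ x, X.N x → X.Lt x n → X.D n x) ∧
    X.Clause n (X.T n) (fun s => ∀ i, X.D n (X.val (X.rho i) s))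
  neg : ∀ n, X.N n → ¬ ∃ R : M → M → Prop, X.Clause n R (fun _ => True)

section SynPart

abbrev Tm (L : FirstOrder.Language.{0,0}) := (LX L).Term ℕ

def tv (n : ℕ) : Tm L := .var n
def trho (t : Tm L) : Tm L := .func (fnX .rho) ![t]
def tval (t u : Tm L) : Tm L := .func (fnX .val) ![t, u]
def r1 (R : XRl 1) (a : Tm L) : Fml (LX L) := .rel (rlX R) ![a]
def r2 (R : XRl 2) (a b : Tm L) : Fml (LX L) := .rel (rlX R) ![a, b]
def r3 (R : XRl 3) (a b c : Tm L) : Fml (LX L) := .rel (rlX R) ![a, b, c]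
def r4 (R : XRl 4) (a b c d : Tm L) : Fml (LX L) := .rel (rlX R) ![a, b, c, d]

def fand (φ ψ : Fml L) : Fml L := .conj Bool fun b => cond b φ ψ
def fimp (φ ψ : Fml L) : Fml L := .not (fand φ (.not ψ))
def ffor (φ ψ : Fml L) : Fml L := fimp (.not φ) ψ
def fiff (φ ψ : Fml L) : Fml L := fand (fimp φ ψ) (fimp ψ φ)
def fex (x : ℕ) (φ : Fml L) : Fml L := .not (.all x (.not φ))
def ftop : Fml L := .conj Empty Empty.elim

section Sem
variable {M : Type} [S : (LX L).Structure M] (va : ℕ → M) (vs : ℕ → Set M) (vr : ℕ → M → M → Prop)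

@[simp] theorem rz_tv (n : ℕ) : (tv n : Tm L).realize va = va n := rfl

@[simp] theorem rz_trho (t : Tm L) : (trho t).realize va = (sysOf S).rho (t.realize va) := by
  simp only [trho, Language.Term.realize, sysOf]
  congr 1
  funext i
  fin_cases i; rfl

@[simp] theorem rz_tval (t u : Tm L) :
    (tval t u).realize va = (sysOf S).val (t.realize va) (u.realize va) := by
  simp only [tval, Language.Term.realize, sysOf]
  congr 1
  funext i
  fin_cases i <;> rfl

theorem ev_r1 (R : XRl 1) (a : Tm L) :
    Eval (r1 R a) va vs vr ↔ S.RelMap (rlX R) ![a.realize va] := by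
  simp only [r1, Eval]
  refine iff_of_eq ?_
  congr 1
  funext i
  fin_cases i; rfl

theorem ev_r2 (R : XRl 2) (a b : Tm L) :
    Eval (r2 R a b) va vs vr ↔ S.RelMap (rlX R) ![a.realize va, b.realize va] := by
  simp only [r2, Eval]
  refine iff_of_eq ?_
  congr 1
  funext i
  fin_cases i <;> rfl

theorem ev_r3 (R : XRl 3) (a b c : Tm L) :
    Eval (r3 R a b c) va vs vr ↔
      S.RelMap (rlX R) ![a.realize va, b.realize va, c.realize va] := by
  simp only [r3, Eval]
  refine iff_of_eq ?_
  congr 1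
  funext i
  fin_cases i <;> rfl

theorem ev_r4 (R : XRl 4) (a b c d : Tm L) :
    Eval (r4 R a b c d) va vs vr ↔
      S.RelMap (rlX R) ![a.realize va, b.realize va, c.realize va, d.realize va] := by
  simp only [r4, Eval]
  refine iff_of_eq ?_
  congr 1
  funext i
  fin_cases i <;> rfl

@[simp] theorem ev_N (a : Tm L) :
    Eval (r1 .N a) va vs vr ↔ (sysOf S).N (a.realize va) := ev_r1 ..
@[simp] theorem ev_E (a b : Tm L) :
    Eval (r2 .E a b) va vs vr ↔ (sysOf S).E (a.realize va) (b.realize va) := ev_r2 ..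
@[simp] theorem ev_Lt (a b : Tm L) :
    Eval (r2 .Lt a b) va vs vr ↔ (sysOf S).Lt (a.realize va) (b.realize va) := ev_r2 ..
@[simp] theorem ev_D (a b : Tm L) :
    Eval (r2 .D a b) va vs vr ↔ (sysOf S).D (a.realize va) (b.realize va) := ev_r2 ..
@[simp] theorem ev_Con (a b : Tm L) :
    Eval (r2 .Con a b) va vs vr ↔ (sysOf S).Con (a.realize va) (b.realize va) := ev_r2 ..
@[simp] theorem ev_Rt (a b : Tm L) :
    Eval (r2 .Rt a b) va vs vr ↔ (sysOf S).Rt (a.realize va) (b.realize va) := ev_r2 ..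
@[simp] theorem ev_T (a b c : Tm L) : Eval (r3 .T a b c) va vs vr ↔
    (sysOf S).T (a.realize va) (b.realize va) (c.realize va) := ev_r3 ..
@[simp] theorem ev_Ch (a b c : Tm L) : Eval (r3 .Ch a b c) va vs vr ↔
    (sysOf S).Ch (a.realize va) (b.realize va) (c.realize va) := ev_r3 ..
@[simp] theorem ev_Mt (a b c d : Tm L) : Eval (r4 .Mt a b c d) va vs vr ↔
    (sysOf S).Mt (a.realize va) (b.realize va) (c.realize va) (d.realize va) := ev_r4 ..

end Sem

section Sem2
variable {M : Type} [S : L.Structure M] (va : ℕ → M) (vs : ℕ → Set M) (vr : ℕ → M → M → Prop)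

@[simp] theorem ev_and (φ ψ : Fml L) :
    Eval (fand φ ψ) va vs vr ↔ Eval φ va vs vr ∧ Eval ψ va vs vr := by
  simp [fand, Eval, and_comm]
@[simp] theorem ev_not (φ : Fml L) : Eval (.not φ) va vs vr ↔ ¬ Eval φ va vs vr := Iff.rfl
@[simp] theorem ev_all (x : ℕ) (φ : Fml L) :
    Eval (.all x φ) va vs vr ↔ ∀ a, Eval φ (Function.update va x a) vs vr := Iff.rfl
@[simp] theorem ev_qII (x : ℕ) (φ : Fml L) :
    Eval (.qII x φ) va vs vr ↔ ∃ r, Eval φ va vs (Function.update vr x r) := Iff.rfl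
@[simp] theorem ev_eq (t u : L.Term ℕ) :
    Eval (.eq t u) va vs vr ↔ t.realize va = u.realize va := Iff.rfl
@[simp] theorem ev_rmem (R : ℕ) (t u : L.Term ℕ) :
    Eval (.rmem R t u) va vs vr ↔ vr R (t.realize va) (u.realize va) := Iff.rfl
@[simp] theorem ev_imp (φ ψ : Fml L) :
    Eval (fimp φ ψ) va vs vr ↔ (Eval φ va vs vr → Eval ψ va vs vr) := by
  simp [fimp]
@[simp] theorem ev_for (φ ψ : Fml L) :
    Eval (ffor φ ψ) va vs vr ↔ (Eval φ va vs vr ∨ Eval ψ va vs vr) := by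
  simp [ffor]; tauto
@[simp] theorem ev_iff (φ ψ : Fml L) :
    Eval (fiff φ ψ) va vs vr ↔ (Eval φ va vs vr ↔ Eval ψ va vs vr) := by
  simp [fiff]; tauto
@[simp] theorem ev_ex (x : ℕ) (φ : Fml L) :
    Eval (fex x φ) va vs vr ↔ ∃ a, Eval φ (Function.update va x a) vs vr := by
  simp [fex]
@[simp] theorem ev_top : Eval (ftop : Fml L) va vs vr ↔ True := by
  simp [ftop, Eval]

end Sem2

/-- A class of formulas: the second order formulas with finite conjunctions, with variables
as indicated. -/
def Cl (κ : Cardinal) (V W : Set ℕ) (φ : Fml L) : Prop :=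
  Ok (LIIInf κ) φ ∧ fv φ ⊆ V ∧ sv φ = ∅ ∧ rv φ ⊆ W

section Closure
variable {κ : Cardinal} (hκ : ℵ₀ ≤ κ) {V W : Set ℕ}

theorem Cl.not {φ : Fml L} (h : Cl κ V W φ) : Cl κ V W (.not φ) := h

theorem Cl.conj {ι : Type} {f : ι → Fml L} (hι : #ι < κ) (h : ∀ i, Cl κ V W (f i)) :
    Cl κ V W (.conj ι f) :=
  ⟨⟨hι, fun i => (h i).1⟩, Set.iUnion_subset fun i => (h i).2.1,
    by simp only [sv, (h _).2.2.1, Set.iUnion_empty], Set.iUnion_subset fun i => (h i).2.2.2⟩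

theorem Cl.all {x : ℕ} {φ : Fml L} (h : Cl κ (insert x V) W φ) : Cl κ V W (.all x φ) :=
  ⟨h.1, by simpa [fv, Set.sdiff_subset_iff] using h.2.1, h.2.2.1, h.2.2.2⟩

theorem Cl.qII {R : ℕ} {φ : Fml L} (h : Cl κ V (insert R W) φ) : Cl κ V W (.qII R φ) :=
  ⟨⟨trivial, h.1⟩, h.2.1, h.2.2.1, by simpa [rv, Set.sdiff_subset_iff] using h.2.2.2⟩

include hκ in
theorem Cl.and {φ ψ : Fml L} (h : Cl κ V W φ) (h' : Cl κ V W ψ) : Cl κ V W (fand φ ψ) :=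
  Cl.conj ((Cardinal.lt_aleph0_of_finite _).trans_le hκ) (by rintro (_ | _); exacts [h', h])

include hκ in
theorem Cl.imp {φ ψ : Fml L} (h : Cl κ V W φ) (h' : Cl κ V W ψ) : Cl κ V W (fimp φ ψ) :=
  (Cl.and hκ h h'.not).not

include hκ in
theorem Cl.for {φ ψ : Fml L} (h : Cl κ V W φ) (h' : Cl κ V W ψ) : Cl κ V W (ffor φ ψ) :=
  Cl.imp hκ h.not h'

include hκ in
theorem Cl.iff {φ ψ : Fml L} (h : Cl κ V W φ) (h' : Cl κ V W ψ) : Cl κ V W (fiff φ ψ) :=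
  Cl.and hκ (Cl.imp hκ h h') (Cl.imp hκ h' h)

theorem Cl.ex {x : ℕ} {φ : Fml L} (h : Cl κ (insert x V) W φ) : Cl κ V W (fex x φ) := h.not.all.not

include hκ in
theorem Cl.top : Cl κ V W (ftop : Fml L) :=
  Cl.conj ((Cardinal.lt_aleph0_of_finite _).trans_le hκ) fun i => i.elim

/-- Terms with variables in `V`. -/
def Tl (V : Set ℕ) (t : L.Term ℕ) : Prop := tvars t ⊆ V

theorem Tl.tv {n : ℕ} (h : n ∈ V) : Tl V (tv n : Tm L) := by simpa [Tl, Hanf.tv, tvars] using h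
theorem Tl.rho {t : Tm L} (h : Tl V t) : Tl V (trho t) :=
  Set.iUnion_subset fun i => by fin_cases i; exact h
theorem Tl.val {t u : Tm L} (h : Tl V t) (h' : Tl V u) : Tl V (tval t u) :=
  Set.iUnion_subset fun i => by fin_cases i; exacts [h, h']
theorem Cl.r1 {R : XRl 1} {a : Tm L} (ha : Tl V a) : Cl κ V W (r1 R a) :=
  ⟨trivial, Set.iUnion_subset fun i => by fin_cases i; exacts [ha], rfl, Set.empty_subset _⟩
theorem Cl.r2 {R : XRl 2} {a b : Tm L} (ha : Tl V a) (hb : Tl V b) : Cl κ V W (r2 R a b) :=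
  ⟨trivial, Set.iUnion_subset fun i => by fin_cases i; exacts [ha, hb], rfl, Set.empty_subset _⟩
theorem Cl.r3 {R : XRl 3} {a b c : Tm L} (ha : Tl V a) (hb : Tl V b) (hc : Tl V c) :
    Cl κ V W (r3 R a b c) :=
  ⟨trivial, Set.iUnion_subset fun i => by fin_cases i; exacts [ha, hb, hc], rfl,
    Set.empty_subset _⟩
theorem Cl.r4 {R : XRl 4} {a b c d : Tm L} (ha : Tl V a) (hb : Tl V b) (hc : Tl V c)
    (hd : Tl V d) : Cl κ V W (r4 R a b c d) :=
  ⟨trivial, Set.iUnion_subset fun i => by fin_cases i; exacts [ha, hb, hc, hd], rfl,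
    Set.empty_subset _⟩
theorem Cl.eq {a b : L.Term ℕ} (ha : Tl V a) (hb : Tl V b) : Cl κ V W (.eq a b) :=
  ⟨trivial, Set.union_subset ha hb, rfl, Set.empty_subset _⟩
theorem Cl.rmem {R : ℕ} {a b : L.Term ℕ} (hR : R ∈ W) (ha : Tl V a) (hb : Tl V b) :
    Cl κ V W (.rmem R a b) :=
  ⟨trivial, Set.union_subset ha hb, rfl, by simpa [rv] using hR⟩

end Closure

/-! The basic conjuncts. -/

def axSeq : Fml (LX L) :=
  .not (.qII 0 (.not (fex 0 (.all 1 (fimp (fex 2 (.rmem 0 (trho (tv 1)) (tv 2)))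
    (.rmem 0 (trho (tv 1)) (tval (trho (tv 1)) (tv 0))))))))

def axExt : Fml (LX L) :=
  .all 0 (.all 1 (fimp (.all 2 (fand
    (fimp (r1 .N (tv 2)) (fiff (r2 .E (tv 2) (tv 0)) (r2 .E (tv 2) (tv 1))))
    (fiff (r2 .E (trho (tv 2)) (tv 0)) (r2 .E (trho (tv 2)) (tv 1)))))
    (.eq (tv 0) (tv 1))))

def axTri : Fml (LX L) :=
  .all 0 (.all 1 (fimp (r1 .N (tv 0)) (fimp (r1 .N (tv 1))
    (ffor (.eq (tv 0) (tv 1)) (ffor (r2 .Lt (tv 0) (tv 1)) (r2 .Lt (tv 1) (tv 0)))))))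

def clF (T : ℕ → ℕ → Fml (LX L)) (Dm : ℕ → Fml (LX L)) : Fml (LX L) :=
  fand
  (.all 1 (fimp (r2 .Con (tv 0) (trho (tv 1))) (.all 2 (fimp (Dm 2) (fiff (T 1 2)
    (.all 3 (.all 4 (fimp (Dm 4) (fimp (r3 .Ch (tv 0) (trho (tv 1)) (trho (tv 3)))
      (fimp (.all 5 (.all 6 (fimp (r4 .Mt (tv 0) (trho (tv 1)) (trho (tv 5)) (trho (tv 6)))
        (.eq (tval (trho (tv 5)) (tv 2)) (tval (trho (tv 6)) (tv 4))))))
        (.not (T 3 4))))))))))))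
  (.all 1 (.all 2 (fimp (r2 .Rt (tv 0) (trho (tv 1))) (fimp (Dm 2) (T 1 2)))))

def axPos : Fml (LX L) :=
  .all 0 (fimp (r1 .N (tv 0)) (fand
    (.all 1 (fimp (r1 .N (tv 1)) (fimp (r2 .Lt (tv 1) (tv 0)) (r2 .D (tv 0) (tv 1)))))
    (clF (fun f s => r3 .T (tv 0) (trho (tv f)) (tv s))
      (fun s => .all 7 (r2 .D (tv 0) (tval (trho (tv 7)) (tv s)))))))

def axNeg : Fml (LX L) :=
  .all 0 (fimp (r1 .N (tv 0)) (.not (.qII 0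
    (clF (fun f s => .rmem 0 (trho (tv f)) (tv s)) (fun _ => ftop)))))

theorem ev_axSeq {M : Type} [S : (LX L).Structure M] (va : ℕ → M) vs vr :
    Eval (axSeq : Fml (LX L)) va vs vr ↔ ∀ R : M → M → Prop, ∃ m, ∀ p,
      (∃ x, R ((sysOf S).rho p) x) → R ((sysOf S).rho p) ((sysOf S).val ((sysOf S).rho p) m) := by
  simp [axSeq]

theorem ev_axExt {M : Type} [S : (LX L).Structure M] (va : ℕ → M) vs vr :
    Eval (axExt : Fml (LX L)) va vs vr ↔ ∀ m m', (∀ x, ((sysOf S).N x →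
      ((sysOf S).E x m ↔ (sysOf S).E x m')) ∧
      ((sysOf S).E ((sysOf S).rho x) m ↔ (sysOf S).E ((sysOf S).rho x) m')) → m = m' := by
  simp [axExt]

theorem ev_axTri {M : Type} [S : (LX L).Structure M] (va : ℕ → M) vs vr :
    Eval (axTri : Fml (LX L)) va vs vr ↔ ∀ x y, (sysOf S).N x → (sysOf S).N y →
      x = y ∨ (sysOf S).Lt x y ∨ (sysOf S).Lt y x := by
  simp [axTri]

theorem ev_axPos {M : Type} [S : (LX L).Structure M] (va : ℕ → M) vs vr :
    Eval (axPos : Fml (LX L)) va vs vr ↔ ∀ n, (sysOf S).N n →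
      (∀ x, (sysOf S).N x → (sysOf S).Lt x n → (sysOf S).D n x) ∧
      (sysOf S).Clause n ((sysOf S).T n)
        (fun s => ∀ i, (sysOf S).D n ((sysOf S).val ((sysOf S).rho i) s)) := by
  simp [axPos, clF, Sys.Clause]

theorem ev_axNeg {M : Type} [S : (LX L).Structure M] (va : ℕ → M) vs vr :
    Eval (axNeg : Fml (LX L)) va vs vr ↔ ∀ n, (sysOf S).N n →
      ¬ ∃ R : M → M → Prop, (sysOf S).Clause n R (fun _ => True) := by
  simp [axNeg, clF, Sys.Clause]

theorem cl_axSeq {κ : Cardinal} (hκ : ℵ₀ ≤ κ) : Cl κ ∅ ∅ (axSeq : Fml (LX L)) := by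
  unfold axSeq
  repeat' first
    | with_reducible apply Cl.not | with_reducible apply Cl.qII | with_reducible apply Cl.ex | with_reducible apply Cl.all | with_reducible apply Cl.imp hκ | with_reducible apply Cl.rmem
    | with_reducible apply Tl.rho | with_reducible apply Tl.val | with_reducible apply Tl.tv
  all_goals simp

theorem cl_axExt {κ : Cardinal} (hκ : ℵ₀ ≤ κ) : Cl κ ∅ ∅ (axExt : Fml (LX L)) := by
  unfold axExt
  repeat' first
    | with_reducible apply Cl.r1 | with_reducible apply Cl.r2 | with_reducible apply Cl.eq | with_reducible apply Cl.imp hκ | with_reducible apply Cl.and hκ | with_reducible apply Cl.iff hκ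
    | with_reducible apply Cl.all | with_reducible apply Tl.rho | with_reducible apply Tl.val | with_reducible apply Tl.tv
  all_goals simp

theorem cl_axTri {κ : Cardinal} (hκ : ℵ₀ ≤ κ) : Cl κ ∅ ∅ (axTri : Fml (LX L)) := by
  unfold axTri
  repeat' first
    | with_reducible apply Cl.r1 | with_reducible apply Cl.r2 | with_reducible apply Cl.eq | with_reducible apply Cl.for hκ | with_reducible apply Cl.imp hκ
    | with_reducible apply Cl.all | with_reducible apply Tl.tv
  all_goals simp

theorem cl_axPos {κ : Cardinal} (hκ : ℵ₀ ≤ κ) : Cl κ ∅ ∅ (axPos : Fml (LX L)) := by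
  unfold axPos clF
  repeat' first
    | with_reducible apply Cl.r1 | with_reducible apply Cl.r2 | with_reducible apply Cl.r3 | with_reducible apply Cl.r4 | with_reducible apply Cl.eq
    | with_reducible apply Cl.iff hκ | with_reducible apply Cl.imp hκ | with_reducible apply Cl.and hκ
    | with_reducible apply Cl.all | with_reducible apply Cl.not | with_reducible apply Tl.rho | with_reducible apply Tl.val | with_reducible apply Tl.tv
  all_goals simp

theorem cl_axNeg {κ : Cardinal} (hκ : ℵ₀ ≤ κ) : Cl κ ∅ ∅ (axNeg : Fml (LX L)) := by
  unfold axNeg clF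
  repeat' first
    | with_reducible apply Cl.r1 | with_reducible apply Cl.r2 | with_reducible apply Cl.r3 | with_reducible apply Cl.r4 | with_reducible apply Cl.eq | with_reducible apply Cl.rmem
    | with_reducible apply Cl.top hκ | with_reducible apply Cl.iff hκ | with_reducible apply Cl.imp hκ | with_reducible apply Cl.and hκ
    | with_reducible apply Cl.all | with_reducible apply Cl.qII | with_reducible apply Cl.not | with_reducible apply Tl.rho | with_reducible apply Tl.val | with_reducible apply Tl.tv
  all_goals simp

end SynPart
/-! ### Relativization -/

def sT : L.Term ℕ → Tm L
  | .var x => trho (tv x)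
  | .func f ts => trho (.func (L := LX L) (Sum.inl f) fun i => sT (ts i))

def sF : Fml L → Fml (LX L)
  | .rel R ts => .rel (L := LX L) (Sum.inl R) fun i => sT (ts i)
  | .eq t₁ t₂ => .eq (sT t₁) (sT t₂)
  | .mem X t => .mem X (sT t)
  | .rmem X t₁ t₂ => .rmem X (sT t₁) (sT t₂)
  | .not φ => .not (sF φ)
  | .conj ι f => .conj ι fun i => sF (f i)
  | .all x φ => .all x (sF φ)
  | .qWo x y φ => .qWo x y (sF φ)
  | .qC X φ => .qC X (sF φ)
  | .qAA X φ => .qAA X (sF φ)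
  | .qII X φ => .qII X (sF φ)
  | .qCf x y φ => .qCf x y (sF φ)

theorem tvars_trho (t : Tm L) : tvars (trho t) = tvars t := by
  ext n
  simp [trho, tvars]

theorem tvars_sT (t : L.Term ℕ) : tvars (sT t) = tvars t := by
  induction t with
  | var x => rw [sT, tvars_trho]; rfl
  | func f ts ih => rw [sT, tvars_trho]; simp only [tvars, ih]

theorem ok_sF (A : Allowed) (φ : Fml L) : Ok A (sF φ) ↔ Ok A φ := by
  induction φ <;> simp_all [sF, Ok]

theorem fv_sF (φ : Fml L) : fv (sF φ) = fv φ := by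
  induction φ <;> simp_all [sF, fv, tvars_sT]

theorem sv_sF (φ : Fml L) : sv (sF φ) = sv φ := by
  induction φ <;> simp_all [sF, sv]

theorem rv_sF (φ : Fml L) : rv (sF φ) = rv φ := by
  induction φ <;> simp_all [sF, rv]

section Rel
variable {M P : Type} [S : (LX L).Structure M] [S₀ : L.Structure P] {i : P → M} {p : M → P}
  (hrho : ∀ m, (sysOf S).rho m = i (p m))
  (hf : ∀ n (f : L.Functions n) a, S₀.funMap f a = p (S.funMap (Sum.inl f) fun k => i (a k)))

include hrho hf

theorem realize_sT (t : L.Term ℕ) (va : ℕ → M) :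
    (sT t).realize va = i (t.realize fun x => p (va x)) := by
  induction t with
  | var x => simp [sT, hrho]
  | func f ts ih =>
    rw [sT, rz_trho, hrho]
    congr 1
    simp only [Language.Term.realize, ih]
    rw [hf]

variable (hi : Function.Injective i) (hp : Function.Surjective p)
  (hR : ∀ n (R : L.Relations n) a, S₀.RelMap R a ↔ S.RelMap (Sum.inl R) fun k => i (a k))

include hi hp hR

theorem eval_sF {κ : Cardinal} (φ : Fml L) (hφ : Ok (LIIInf κ) φ) (va : ℕ → M) (vs : ℕ → Set M)
    (vr : ℕ → M → M → Prop) : Eval (sF φ) va vs vr ↔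
      Eval φ (fun x => p (va x)) (fun X => i ⁻¹' vs X) (fun R a b => vr R (i a) (i b)) := by
  have ht := fun t va => realize_sT hrho hf t va
  induction φ generalizing va vr with
  | rel R ts =>
    simp only [sF, Eval, ht]
    exact (hR _ _ _).symm
  | eq t₁ t₂ => simp only [sF, Eval, ht, hi.eq_iff]
  | mem X t => simp only [sF, Eval, ht, Set.mem_preimage]
  | rmem X t₁ t₂ => simp only [sF, Eval, ht]
  | not φ ih => exact not_congr (ih hφ va vr)
  | conj ι f ih => exact forall_congr' fun i => ih i (hφ.2 i) va vr
  | all x φ ih =>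
    have key : ∀ a, (fun y => p (Function.update va x a y)) =
        Function.update (fun y => p (va y)) x (p a) := by
      intro a
      funext y
      by_cases hy : y = x
      · subst hy; simp
      · simp [Function.update_of_ne hy]
    simp only [sF, ev_all, ih hφ, key]
    exact ⟨fun h a => by obtain ⟨b, rfl⟩ := hp a; exact h b, fun h a => h _⟩
  | qWo x y φ ih => exact hφ.1.elim
  | qC X φ ih => exact hφ.1.elim
  | qAA X φ ih => exact hφ.1.elim
  | qII X φ ih =>
    have key : ∀ r, (fun R a b => Function.update vr X r R (i a) (i b)) =
        Function.update (fun R a b => vr R (i a) (i b)) X (fun a b => r (i a) (i b)) := by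
      intro r
      funext Y
      by_cases hY : Y = X
      · subst hY; simp
      · simp [Function.update_of_ne hY]
    simp only [sF, ev_qII, ih hφ.2, key]
    constructor
    · rintro ⟨r, h⟩
      exact ⟨_, h⟩
    · rintro ⟨r, h⟩
      refine ⟨fun a b => ∃ c d, i c = a ∧ i d = b ∧ r c d, ?_⟩
      convert h using 2
      funext a b
      refine propext ⟨?_, fun h => ⟨a, b, rfl, rfl, h⟩⟩
      rintro ⟨c, d, hc, hd, h⟩
      rwa [hi hc, hi hd] at h
  | qCf x y φ ih => exact hφ.1.elim

theorem sat_sF {κ : Cardinal} (φ : Fml L) (hφ : Ok (LIIInf κ) φ) :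
    Sat M (sF φ) ↔ Sat P φ := by
  constructor
  · intro h va vs vr
    choose q hq using hp
    have := (eval_sF hrho hf hi (fun b => ⟨q b, hq b⟩) hR φ hφ (fun x => q (va x))
      (fun X => Set.image i (vs X)) (fun R a b => ∃ c d, i c = a ∧ i d = b ∧ vr R c d)).1 (h _ _ _)
    convert this using 2
    · exact (hq _).symm
    · exact (Set.preimage_image_eq _ hi).symm
    · funext a b
      refine propext ⟨fun h => ⟨a, b, rfl, rfl, h⟩, ?_⟩
      rintro ⟨c, d, hc, hd, h⟩
      rwa [hi hc, hi hd] at h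
  · intro h va vs vr
    exact (eval_sF hrho hf hi hp hR φ hφ _ _ _).2 (h _ _ _)

end Rel

/-- The main sentence. -/
def theta (ψ : Fml L) : Fml (LX L) :=
  fand (sF ψ) (fand axSeq (fand axExt (fand axTri (fand axPos axNeg))))

theorem cl_theta {κ : Cardinal} (hκ : ℵ₀ ≤ κ) (ψ : Fml L) (hs : IsSentence ψ)
    (hψ : Ok (LIIInf κ) ψ) : IsSentence (theta ψ) ∧ Ok (LIIInf κ) (theta ψ) := by
  have h1 : Cl κ ∅ ∅ (sF ψ) :=
    ⟨(ok_sF _ _).2 hψ, by rw [fv_sF, hs.1], by rw [sv_sF, hs.2.1], by rw [rv_sF, hs.2.2]⟩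
  have h2 : Cl κ ∅ ∅ (theta ψ) := Cl.and hκ h1 (Cl.and hκ (cl_axSeq hκ) (Cl.and hκ (cl_axExt hκ)
    (Cl.and hκ (cl_axTri hκ) (Cl.and hκ (cl_axPos hκ) (cl_axNeg hκ)))))
  exact ⟨⟨Set.subset_empty_iff.1 h2.2.1, h2.2.2.1, Set.subset_empty_iff.1 h2.2.2.2⟩, h2.1⟩

theorem sat_theta {M : Type} [Nonempty M] [S : (LX L).Structure M] (ψ : Fml L) :
    Sat M (theta ψ) ↔ Sat M (sF ψ) ∧ (sysOf S).Good := by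
  constructor
  · intro h
    refine ⟨fun va vs vr => ((ev_and ..).1 (h va vs vr)).1, ?_⟩
    obtain ⟨a⟩ := ‹Nonempty M›
    have h := h (fun _ => a) (fun _ => ∅) (fun _ _ _ => False)
    simp only [theta, ev_and, ev_axSeq, ev_axExt, ev_axTri, ev_axPos, ev_axNeg] at h
    exact ⟨h.2.1, h.2.2.1, h.2.2.2.1, h.2.2.2.2.1, h.2.2.2.2.2⟩
  · rintro ⟨h1, h2⟩ va vs vr
    simp only [theta, ev_and, ev_axSeq, ev_axExt, ev_axTri, ev_axPos, ev_axNeg]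
    exact ⟨h1 va vs vr, h2.seq, h2.ext, h2.tri, h2.pos, h2.neg⟩
/-! ### Boundedness -/

section Bound
variable {M : Type} (X : Sys M)

/-- The set of parameters. -/
def Sys.P : Set M := Set.range X.rho

/-- The sequence coded by an element. -/
def Sys.dec (m : M) : X.P → M := fun p => X.val p m

/-- The code given by an element. -/
def Sys.code (n : M) : Code X.P where
  con f := X.Con n f
  ch f g := X.Ch n f g
  mt f i j := X.Mt n f i j
  rt f := X.Rt n f

variable {X}

theorem Sys.forall_P {q : X.P → Prop} :
    (∀ p, q p) ↔ ∀ f, q ⟨X.rho f, f, rfl⟩ :=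
  ⟨fun h f => h _, by rintro h ⟨_, f, rfl⟩; exact h f⟩

theorem Sys.Good.surj (h : X.Good) : Function.Surjective X.dec := by
  intro g
  obtain ⟨m, hm⟩ := h.seq fun a b => ∃ h : a ∈ X.P, b = g ⟨a, h⟩
  refine ⟨m, funext ?_⟩
  rw [Sys.forall_P]
  intro f
  obtain ⟨_, h2⟩ := hm f ⟨_, ⟨f, rfl⟩, rfl⟩
  exact h2

theorem Sys.clause_iff {n : M} {T : M → M → Prop} {Dm : M → Prop} : X.Clause n T Dm ↔
    (∀ f : X.P, (X.code n).con f → ∀ s, Dm s → (T f s ↔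
      ∀ (g : X.P) s', Dm s' → (X.code n).ch f g →
      (∀ i j, (X.code n).mt f i j → X.dec s i = X.dec s' j) → ¬ T g s')) ∧
    ∀ (f : X.P) s, (X.code n).rt f → Dm s → T f s := by
  simp only [Sys.forall_P]
  exact Iff.rfl

theorem Sys.Good.mod_of_clause (h : X.Good) {n : M} {T : M → M → Prop} {D : M → Prop}
    (hc : X.Clause n T (fun s => ∀ i, D (X.val (X.rho i) s))) :
    Mod (X.code n) {x // D x} := by
  have hD : ∀ s, (∀ i, D (X.val (X.rho i) s)) ↔ ∀ i, D (X.dec s i) := fun s =>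
    (Sys.forall_P (X := X) (q := fun p => D (X.dec s p))).symm
  simp only [hD] at hc
  rw [Sys.clause_iff] at hc
  obtain ⟨h1, h2⟩ := hc
  have hcode : ∀ u : X.P → {x // D x}, ∃ s, ∀ i, X.dec s i = u i := fun u => by
    obtain ⟨s, hs⟩ := h.surj fun i => (u i).1
    exact ⟨s, fun i => by rw [hs]⟩
  refine ⟨fun f u => ∃ s, (∀ i, X.dec s i = u i) ∧ T f s, ?_, ?_⟩
  · intro f hf u
    have key : ∀ s, (∀ i, X.dec s i = u i) → (T f s ↔ ∀ (g : X.P) (u' : X.P → {x // D x}),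
        (X.code n).ch f g → (∀ i j, (X.code n).mt f i j → u i = u' j) →
        ¬ ∃ s', (∀ i, X.dec s' i = u' i) ∧ T g s') := by
      intro s hs
      rw [h1 f hf s (fun i => by rw [hs]; exact (u i).2)]
      constructor
      · rintro h3 g u' hg hm ⟨s', hs', hT⟩
        refine h3 g s' (fun i => by rw [hs']; exact (u' i).2) hg (fun i j hij => ?_) hT
        rw [hs, hs', hm i j hij]
      · intro h3 g s' hs' hg hm hT
        refine h3 g (fun i => ⟨X.dec s' i, hs' i⟩) hg (fun i j hij => ?_) ⟨s', fun i => rfl, hT⟩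
        apply Subtype.ext
        rw [← hs, hm i j hij]
    constructor
    · rintro ⟨s, hs, hT⟩
      exact (key s hs).1 hT
    · intro h3
      obtain ⟨s, hs⟩ := hcode u
      exact ⟨s, hs, (key s hs).2 h3⟩
  · intro f u hf
    obtain ⟨s, hs⟩ := hcode u
    exact ⟨s, hs, h2 f s hf fun i => by rw [hs]; exact (u i).2⟩

theorem Sys.clause_of_mod (hsurj : Function.Surjective X.dec) {n : M} (hm : Mod (X.code n) M) :
    ∃ R : M → M → Prop, X.Clause n R (fun _ => True) := by
  obtain ⟨T, h1, h2⟩ := hm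
  refine ⟨fun a s => ∃ h : a ∈ X.P, T ⟨a, h⟩ (X.dec s), Sys.clause_iff.2 ⟨?_, ?_⟩⟩
  · intro f hf s _
    simp only [Subtype.coe_prop, exists_true_left, Subtype.coe_eta, h1 f hf]
    constructor
    · intro h3 g s' _ hg hm
      exact h3 g _ hg hm
    · intro h3 g u hg hm
      obtain ⟨s', rfl⟩ := hsurj u
      exact h3 g s' trivial hg hm
  · intro f s hf _
    simp only [Subtype.coe_prop, exists_true_left, Subtype.coe_eta]
    exact h2 f _ hf

theorem card_of_tri {α : Type} (N : α → Prop) (lt : α → α → Prop) (H : Cardinal) (hH : ℵ₀ ≤ H)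
    (tri : ∀ x y, N x → N y → x = y ∨ lt x y ∨ lt y x)
    (hp : ∀ n, N n → #{x // N x ∧ lt x n} ≤ H) : #{x // N x} ≤ Order.succ H := by
  by_contra hc
  push Not at hc
  have hH' : ℵ₀ ≤ Order.succ H := hH.trans (Order.le_succ _)
  obtain ⟨Y, hY⟩ := Cardinal.le_mk_iff_exists_set.1 hc.le
  let Z : Set {x // N x} := Y ∪ ⋃ y : Y, {x | lt x.1 y.1.1}
  have hZ : #Z < #{x // N x} := by
    refine lt_of_le_of_lt ?_ hc
    refine (Cardinal.mk_union_le _ _).trans (Cardinal.add_le_of_le hH' hY.le ?_)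
    refine (Cardinal.mk_iUnion_le _).trans ?_
    refine (mul_le_mul' hY.le (ciSup_le' (a := Order.succ H) fun y => ?_)).trans
      (Cardinal.mul_eq_self hH').le
    refine le_trans ?_ ((hp y.1.1 y.1.2).trans (Order.le_succ _))
    refine Cardinal.mk_le_of_injective
      (f := fun x : {x : {x // N x} | lt x.1 y.1.1} => (⟨x.1.1, x.1.2, x.2⟩ : {x // N x ∧ lt x y.1.1})) ?_
    intro a b hab
    have := congrArg Subtype.val hab
    exact Subtype.ext (Subtype.ext this)
  obtain ⟨n, hn⟩ : ∃ n, n ∉ Z := by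
    by_contra hall
    push Not at hall
    rw [Set.eq_univ_of_forall hall, Cardinal.mk_univ] at hZ
    exact lt_irrefl _ hZ
  have h1 : #Y ≤ H := by
    refine le_trans ?_ (hp n.1 n.2)
    refine Cardinal.mk_le_of_injective
      (f := fun y : Y => (⟨y.1.1, y.1.2, ?_⟩ : {x // N x ∧ lt x n.1})) ?_
    · rcases tri y.1.1 n.1 y.1.2 n.2 with h | h | h
      · exact absurd (Or.inl (by rw [← Subtype.ext h]; exact y.2)) hn
      · exact h
      · exact absurd (Or.inr (Set.mem_iUnion.2 ⟨y, h⟩)) hn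
    · intro a b hab
      have := congrArg Subtype.val hab
      exact Subtype.ext (Subtype.ext this)
  rw [hY] at h1
  exact absurd h1 (not_le.2 (Order.lt_succ H))

end Bound

theorem good_bound (K : Type) : ∃ B : Cardinal.{0}, ∀ (M : Type) (X : Sys M), X.Good →
    #X.P ≤ #K → #M < B := by
  classical
  let b : (Σ Q : Set K, Code Q) → Cardinal.{0} := fun x =>
    if h : ∃ κ : Cardinal.{0}, ∀ A : Type, Mod x.2 A → #A < κ then h.choose else 0
  let H : Cardinal.{0} := max ℵ₀ (⨆ x, b x)
  have hH : ℵ₀ ≤ H := le_max_left _ _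
  refine ⟨max ℵ₀ (Order.succ (2 ^ (Order.succ H + #K))), fun M X h hPK => ?_⟩
  rcases finite_or_infinite M with hfin | hinf
  · exact lt_max_of_lt_left (Cardinal.lt_aleph0_of_finite M)
  refine lt_max_of_lt_right (Order.lt_succ_iff.2 ?_)
  have hM : ℵ₀ ≤ #M := Cardinal.aleph0_le_mk M
  have hpow : #M ^ #X.P ≤ #M := by
    rw [Cardinal.power_def]
    exact Cardinal.mk_le_of_surjective h.surj
  obtain ⟨j⟩ := Cardinal.le_def _ _ |>.1 hPK
  let e : X.P ≃ Set.range j := Equiv.ofInjective j j.injective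
  have hD : ∀ n, X.N n → #{x // X.D n x} ≤ H := by
    intro n hn
    have hbd : ∃ κ : Cardinal.{0}, ∀ A : Type, Mod ((X.code n).map e) A → #A < κ := by
      refine ⟨#M, fun A hA => ?_⟩
      rw [mod_map_iff] at hA
      by_contra hc
      push Not at hc
      exact h.neg n hn (Sys.clause_of_mod h.surj
        (hA.down hM (Cardinal.mk_set_le _) hpow hc))
    have h1 := (mod_map_iff e).2 (h.mod_of_clause (h.pos n hn).2)
    have h2 := hbd.choose_spec _ h1
    have h3 : hbd.choose = b ⟨Set.range j, (X.code n).map e⟩ := by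
      simp only [b]
      rw [dif_pos hbd]
    rw [h3] at h2
    exact (h2.le.trans (le_ciSup (Cardinal.bddAbove_range b) _)).trans (le_max_right _ _)
  have hN : #{x // X.N x} ≤ Order.succ H := by
    refine card_of_tri X.N X.Lt H hH h.tri fun n hn => le_trans ?_ (hD n hn)
    refine Cardinal.mk_subtype_mono fun x hx => (h.pos n hn).1 x hx.1 hx.2
  have hi : Function.Injective
      (fun m : M => {z : {x // X.N x} ⊕ X.P | Sum.elim (fun x => X.E x.1 m) (fun p => X.E p.1 m) z}) := by
    intro m m' hmm
    refine h.ext m m' fun x => ⟨fun hx => ?_, ?_⟩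
    · have := Set.ext_iff.1 hmm (Sum.inl ⟨x, hx⟩)
      exact this
    · have := Set.ext_iff.1 hmm (Sum.inr ⟨X.rho x, x, rfl⟩)
      exact this
  refine (Cardinal.mk_le_of_injective hi).trans ?_
  rw [Cardinal.mk_set, Cardinal.mk_sum]
  simp only [Cardinal.lift_id]
  exact Cardinal.power_le_power_left two_ne_zero (add_le_add hN hPK)

theorem theta_bdd (ψ : Fml L) {κ : Cardinal} (hψ : Ok (LIIInf κ) ψ) (hb : BddSpec ψ) :
    BddSpec (theta ψ) := by
  obtain ⟨β, hβ⟩ := hb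
  obtain ⟨B, hB⟩ := good_bound β.out
  refine ⟨max 1 B, fun M S hS => ?_⟩
  rcases isEmpty_or_nonempty M with hM | hM
  · rw [Cardinal.mk_eq_zero]
    exact lt_max_of_lt_left zero_lt_one
  refine lt_max_of_lt_right ?_
  obtain ⟨h1, h2⟩ := (sat_theta ψ).1 hS
  refine hB M _ h2 ?_
  rw [Cardinal.mk_out]
  let i : (sysOf S).P → M := Subtype.val
  let p : M → (sysOf S).P := fun m => ⟨(sysOf S).rho m, m, rfl⟩
  let S₀ : L.Structure (sysOf S).P :=
    { funMap := fun f a => p (S.funMap (Sum.inl f) fun k => i (a k))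
      RelMap := fun R a => S.RelMap (Sum.inl R) fun k => i (a k) }
  refine (hβ _ S₀ ?_).le
  refine (sat_sF (i := i) (p := p) (fun _ => rfl) (fun _ _ _ => rfl) Subtype.val_injective ?_
    (fun _ _ _ => Iff.rfl) ψ hψ).1 h1
  rintro ⟨_, m, rfl⟩
  exact ⟨m, rfl⟩
/-! ### Existence of large models -/

/-- The structure given by a system. -/
def structOf {M P : Type} (X : Sys M) (S₀ : L.Structure P) (i : P → M) (p : M → P) :
    (LX L).Structure M where
  funMap := fun {n} f => match n, f with
    | _, Sum.inl f => fun a => i (S₀.funMap f fun k => p (a k))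
    | _, Sum.inr .rho => fun a => X.rho (a 0)
    | _, Sum.inr .val => fun a => X.val (a 0) (a 1)
  RelMap := fun {n} R => match n, R with
    | _, Sum.inl R => fun a => S₀.RelMap R fun k => p (a k)
    | _, Sum.inr .N => fun a => X.N (a 0)
    | _, Sum.inr .E => fun a => X.E (a 0) (a 1)
    | _, Sum.inr .Lt => fun a => X.Lt (a 0) (a 1)
    | _, Sum.inr .D => fun a => X.D (a 0) (a 1)
    | _, Sum.inr .T => fun a => X.T (a 0) (a 1) (a 2)
    | _, Sum.inr .Con => fun a => X.Con (a 0) (a 1)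
    | _, Sum.inr .Ch => fun a => X.Ch (a 0) (a 1) (a 2)
    | _, Sum.inr .Mt => fun a => X.Mt (a 0) (a 1) (a 2) (a 3)
    | _, Sum.inr .Rt => fun a => X.Rt (a 0) (a 1)

theorem sysOf_structOf {M P : Type} (X : Sys M) (S₀ : L.Structure P) (i : P → M) (p : M → P) :
    sysOf (structOf X S₀ i p) = X := rfl

theorem exists_big {P N : Type} [Infinite P] [Nonempty N] (lt : N → N → Prop)
    (tri : ∀ x y, x = y ∨ lt x y ∨ lt y x) (c : N → Code P) (A : N → Type)
    (hA : ∀ n, Mod (c n) (A n)) (hinf : ∀ n, ℵ₀ ≤ #(A n))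
    (hpred : ∀ n, #{m // lt m n} ≤ #(A n)) (hle : ∀ n, #(A n) ≤ #(Set (N ⊕ P)))
    (hno : ∀ n, ¬ Mod (c n) (Set (N ⊕ P))) {κ : Cardinal} (ψ : Fml L) (hψ : Ok (LIIInf κ) ψ)
    (S₀ : L.Structure P) (hsat : @Sat L P S₀ ψ) :
    ∃ S : (LX L).Structure (Set (N ⊕ P)), @Sat _ _ S (theta ψ) := by
  classical
  have hpow : #(P → Set (N ⊕ P)) ≤ #(Set (N ⊕ P)) := by
    rw [← Cardinal.power_def, Cardinal.mk_set, ← Cardinal.power_mul]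
    refine Cardinal.power_le_power_left two_ne_zero ?_
    have h1 : #P ≤ #(N ⊕ P) := Cardinal.mk_le_of_injective Sum.inr_injective
    have h2 : ℵ₀ ≤ #(N ⊕ P) := (Cardinal.aleph0_le_mk P).trans h1
    exact (mul_le_mul' le_rfl h1).trans (Cardinal.mul_eq_self h2).le
  set M := Set (N ⊕ P) with hM
  have hMne : Nonempty M := ⟨(∅ : Set (N ⊕ P))⟩
  obtain ⟨enc⟩ := Cardinal.le_def _ _ |>.1 hpow
  obtain ⟨d, hd⟩ : ∃ d : M → P → M, Function.Surjective d :=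
    ⟨_, Function.invFun_surjective enc.injective⟩
  let jN : N → M := fun n => ({Sum.inl n} : Set (N ⊕ P))
  let jP : P → M := fun n => ({Sum.inr n} : Set (N ⊕ P))
  have hjN : Function.Injective jN := fun a b hab => by
    have := Set.singleton_injective hab
    exact Sum.inl_injective this
  have hjP : Function.Injective jP := fun a b hab => by
    have := Set.singleton_injective hab
    exact Sum.inr_injective this
  let nn : M → N := Function.invFun jN
  let pp : M → P := Function.invFun jP
  have hnn : ∀ n, nn (jN n) = n := Function.leftInverse_invFun hjN
  have hpp : ∀ n, pp (jP n) = n := Function.leftInverse_invFun hjP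
  have hDex : ∀ n, ∃ D : Set M, (∀ m, lt m n → jN m ∈ D) ∧ #D = #(A n) := by
    intro n
    obtain ⟨W, hW⟩ := Cardinal.le_mk_iff_exists_set.1 (hle n)
    refine ⟨W ∪ Set.image jN {m | lt m n}, fun m hm => Or.inr ⟨m, hm, rfl⟩, le_antisymm ?_ ?_⟩
    · refine (Cardinal.mk_union_le _ _).trans (Cardinal.add_le_of_le (hinf n) hW.le ?_)
      exact Cardinal.mk_image_le.trans (hpred n)
    · rw [← hW]
      exact Cardinal.mk_le_mk_of_subset Set.subset_union_left
  choose Dn hDn hDc using hDex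
  have hT : ∀ n, Mod (c n) (Dn n) := fun n => by
    obtain ⟨e⟩ := Cardinal.eq.1 (hDc n)
    exact (hA n).congr e.symm
  choose Tn hTn using hT
  let X : Sys M :=
    { rho := fun a => jP (pp a)
      val := fun a m => d m (pp a)
      N := fun x => ∃ n, x = jN n
      E := fun x m => ∃ z : N ⊕ P, x = ({z} : Set (N ⊕ P)) ∧ z ∈ (m : Set (N ⊕ P))
      Lt := fun x y => lt (nn x) (nn y)
      D := fun x y => y ∈ Dn (nn x)
      T := fun x f s => ∃ u : P → Dn (nn x), (∀ i, (u i).1 = d s i) ∧ Tn (nn x) (pp f) u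
      Con := fun x f => (c (nn x)).con (pp f)
      Ch := fun x f g => (c (nn x)).ch (pp f) (pp g)
      Mt := fun x f i j => (c (nn x)).mt (pp f) (pp i) (pp j)
      Rt := fun x f => (c (nn x)).rt (pp f) }
  have hsp : Function.Surjective pp := fun p => ⟨jP p, hpp p⟩
  have hE : ∀ (z : N ⊕ P) (m : M), X.E ({z} : Set (N ⊕ P)) m ↔ z ∈ (m : Set (N ⊕ P)) := by
    intro z m
    constructor
    · rintro ⟨z', h1, h2⟩
      rwa [Set.singleton_injective h1]
    · intro h
      exact ⟨z, rfl, h⟩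
  have hgood : X.Good := by
    refine ⟨?_, ?_, ?_, ?_, ?_⟩
    · intro R
      obtain ⟨m, hm⟩ := hd fun p => if h : ∃ x, R (jP p) x then h.choose else jP p
      refine ⟨m, fun p hp => ?_⟩
      have h1 : X.val (X.rho p) m = Exists.choose hp := by
        change d m (pp (jP (pp p))) = _
        rw [hpp, hm]
        exact dif_pos hp
      rw [h1]
      exact hp.choose_spec
    · intro m m' h
      refine Set.ext fun z => ?_
      rw [← hE, ← hE]
      rcases z with n | p
      · exact (h (jN n)).1 ⟨n, rfl⟩
      · have := (h (jP p)).2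
        change X.E (jP (pp (jP p))) m ↔ X.E (jP (pp (jP p))) m' at this
        rw [hpp] at this
        exact this
    · rintro _ _ ⟨x, rfl⟩ ⟨y, rfl⟩
      simp only [X, hnn, hjN.eq_iff]
      exact tri x y
    · rintro _ ⟨n, rfl⟩
      refine ⟨?_, ?_, ?_⟩
      · rintro _ ⟨m, rfl⟩ h
        simp only [X, hnn] at h ⊢
        exact hDn _ _ h
      · intro f hf s hs
        obtain ⟨h1, h2⟩ := hTn (nn (jN n))
        simp only [X, hpp] at hf hs ⊢
        have hs' : ∀ p, d s p ∈ Dn (nn (jN n)) := fun p => by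
          obtain ⟨i, rfl⟩ := hsp p
          exact hs i
        have key : (∃ u : P → Dn (nn (jN n)), (∀ i, (u i).1 = d s i) ∧ Tn (nn (jN n)) (pp f) u) ↔
            Tn (nn (jN n)) (pp f) (fun p => ⟨d s p, hs' p⟩) := by
          constructor
          · rintro ⟨u, hu, h⟩
            convert h using 2
            exact Subtype.ext (hu _).symm
          · intro h
            exact ⟨_, fun i => rfl, h⟩
        rw [key, h1 _ hf]
        constructor
        · rintro h3 g s' hs2 hg hm ⟨u, hu, h4⟩
          refine h3 (pp g) u hg (fun i j hij => ?_) h4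
          obtain ⟨i, rfl⟩ := hsp i
          obtain ⟨j, rfl⟩ := hsp j
          exact Subtype.ext ((hm i j hij).trans (hu _).symm)
        · intro h3 g u hg hm h4
          obtain ⟨g, rfl⟩ := hsp g
          obtain ⟨s', hs2⟩ := hd fun i => (u i).1
          refine h3 g s' (fun i => ?_) hg (fun i j hij => ?_) ⟨u, fun i => by rw [hs2], h4⟩
          · rw [hs2]
            exact (u _).2
          · rw [hs2]
            exact congrArg Subtype.val (hm (pp i) (pp j) hij)
      · intro f s hf hs
        obtain ⟨h1, h2⟩ := hTn (nn (jN n))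
        simp only [X, hpp] at hf hs ⊢
        have hs' : ∀ p, d s p ∈ Dn (nn (jN n)) := fun p => by
          obtain ⟨i, rfl⟩ := hsp p
          exact hs i
        exact ⟨fun p => ⟨d s p, hs' p⟩, fun i => rfl, h2 _ _ hf⟩
    · rintro _ ⟨n, rfl⟩ ⟨R, h1, h2⟩
      refine hno n ⟨fun f u => ∃ s, d s = u ∧ R (jP f) s, ?_, ?_⟩
      · intro f hf u
        obtain ⟨f, rfl⟩ := hsp f
        have h3 := h1 f (by simpa only [X, hpp, hnn] using hf)
        simp only [X, hpp, hnn, true_implies] at h3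
        have key : ∀ s, d s = u → (R (jP (pp f)) s ↔ ∀ g (s' : P → M), (c n).ch (pp f) g →
            (∀ i j, (c n).mt (pp f) i j → u i = s' j) → ¬ ∃ s, d s = s' ∧ R (jP g) s) := by
          rintro s rfl
          rw [h3]
          constructor
          · rintro h4 g _ hg hm ⟨s', rfl, h5⟩
            obtain ⟨g, rfl⟩ := hsp g
            exact h4 g s' hg (fun i j hij => hm _ _ hij) h5
          · intro h4 g s' hg hm h5
            refine h4 (pp g) _ hg (fun i j hij => ?_) ⟨s', rfl, h5⟩
            obtain ⟨i, rfl⟩ := hsp i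
            obtain ⟨j, rfl⟩ := hsp j
            exact hm i j hij
        constructor
        · rintro ⟨s, hs, h⟩
          exact (key s hs).1 h
        · intro h
          obtain ⟨s, hs⟩ := hd u
          exact ⟨s, hs, (key s hs).2 h⟩
      · intro f u hf
        obtain ⟨f, rfl⟩ := hsp f
        obtain ⟨s, rfl⟩ := hd u
        refine ⟨s, rfl, h2 f s ?_ trivial⟩
        simpa only [X, hpp, hnn] using hf
  refine ⟨structOf X S₀ jP pp, ?_⟩
  let S : (LX L).Structure M := structOf X S₀ jP pp
  refine (sat_theta ψ).2 ⟨?_, hgood⟩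
  refine (sat_sF (i := jP) (p := pp) (fun _ => rfl) ?_ hjP hsp ?_ ψ hψ).2 hsat
  · intro n f a
    change _ = pp (jP (S₀.funMap f fun k => pp (jP (a k))))
    simp only [hpp]
  · intro n R a
    change _ ↔ S₀.RelMap R fun k => pp (jP (a k))
    simp only [hpp]
/-! ### The main argument -/

theorem succ_mk_le_hanfVal {φ : Fml L} (hb : BddSpec φ) (M : Type) (S : L.Structure M)
    (h : @Sat L M S φ) : Order.succ #M ≤ hanfVal φ := by
  obtain ⟨κ, hκ⟩ := hb
  refine le_csSup ⟨κ, ?_⟩ ⟨M, S, h, rfl⟩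
  rintro _ ⟨M', S', h', rfl⟩
  exact Order.succ_le_of_lt (hκ M' S' h')

theorem exists_model_of_lt {φ : Fml L} {c : Cardinal} (h : c < hanfVal φ) :
    ∃ (M : Type) (S : L.Structure M), @Sat L M S φ ∧ c ≤ #M := by
  obtain ⟨_, ⟨M, S, hM, rfl⟩, hlt⟩ := exists_lt_of_lt_csSup' h
  exact ⟨M, S, hM, Order.lt_succ_iff.1 hlt⟩

theorem exists_of_lt_hanfNum {A : Allowed} {c : Cardinal} (h : c < hanfNum A) :
    ∃ (L : FirstOrder.Language.{0,0}) (φ : Fml L), IsSentence φ ∧ Ok A φ ∧ BddSpec φ ∧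
      c < hanfVal φ := by
  obtain ⟨_, ⟨L, φ, h1, h2, h3, rfl⟩, hlt⟩ := exists_lt_of_lt_csSup' h
  exact ⟨L, φ, h1, h2, h3, hlt⟩

theorem hanfVal_le_hanfNum {A : Allowed} (h : hanfNum A ≠ 0) {φ : Fml L} (h1 : IsSentence φ)
    (h2 : Ok A φ) (h3 : BddSpec φ) : hanfVal φ ≤ hanfNum A := by
  refine le_csSup ?_ ⟨L, φ, h1, h2, h3, rfl⟩
  by_contra hb
  apply h
  rw [hanfNum, csSup_of_not_bddAbove hb, csSup_empty]
  rfl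

theorem main_first (lam mu : Cardinal.{0}) (hlam : ℵ₀ ≤ lam) (hmu : ℵ₀ ≤ mu)
    (hlt : lam < hanfNum (LIIInf mu)) :
    hanfNum (LcInf (Order.succ lam)) < hanfNum (LIIInf mu) := by
  rcases le_or_gt (hanfNum (LcInf (Order.succ lam))) lam with hle | hgt
  · exact hle.trans_lt hlt
  obtain ⟨N, hN⟩ : ∃ N : Type, #N = hanfNum (LcInf (Order.succ lam)) :=
    ⟨_, Cardinal.mk_out _⟩
  have h0 : hanfNum (LcInf (Order.succ lam)) ≠ 0 := (bot_lt_of_lt hgt).ne'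
  have : Nonempty N := Cardinal.mk_ne_zero_iff.1 (hN ▸ h0)
  obtain ⟨Lψ, ψ, hψs, hψok, hψb, hψlt⟩ := exists_of_lt_hanfNum hlt
  obtain ⟨P, S₀, hsat, hP⟩ := exists_model_of_lt hψlt
  have : Infinite P := Cardinal.infinite_iff.2 (hlam.trans hP)
  obtain ⟨r, hr, hord⟩ := Cardinal.exists_ord_eq N
  have hbig : hanfNum (LcInf (Order.succ lam)) < #(Set (N ⊕ P)) := by
    rw [← hN, Cardinal.mk_set]
    refine lt_of_le_of_lt ?_ (Cardinal.cantor _)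
    rw [Cardinal.mk_sum]
    simp
  have key : ∀ n : N, ∃ (c : Code P) (A : Type), Mod c A ∧ ℵ₀ ≤ #A ∧ #{m // r m n} ≤ #A ∧
      #A ≤ #(Set (N ⊕ P)) ∧ ¬ Mod c (Set (N ⊕ P)) := by
    intro n
    have h1 : #{m // r m n} < hanfNum (LcInf (Order.succ lam)) := by
      rw [← hN]
      exact Cardinal.card_typein_lt n hord
    obtain ⟨L', φ, hs, hok, hb, hφ⟩ := exists_of_lt_hanfNum (max_lt h1 hgt)
    obtain ⟨A, S, hA, hAle⟩ := exists_model_of_lt hφ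
    obtain ⟨c, hc⟩ := exists_code_fml (P := P) (Order.succ_le_succ hP) φ hs hok
    have hAinf : ℵ₀ ≤ #A := hlam.trans ((le_max_right _ _).trans hAle)
    have : Infinite A := Cardinal.infinite_iff.2 hAinf
    have hval := hanfVal_le_hanfNum h0 hs hok hb
    refine ⟨c, A, (hc A inferInstance).2 ⟨S, hA⟩, hAinf, (le_max_left _ _).trans hAle, ?_, ?_⟩
    · exact (Order.le_succ _).trans ((succ_mk_le_hanfVal hb A S hA).trans (hval.trans hbig.le))
    · intro hm
      obtain ⟨S', hS'⟩ := (hc _ inferInstance).1 hm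
      exact absurd ((Order.le_succ _).trans ((succ_mk_le_hanfVal hb _ S' hS').trans hval))
        hbig.not_ge
  choose c A hA hinf hpred hle hno using key
  obtain ⟨S, hS⟩ := exists_big r (fun x y => by
    rcases trichotomous_of r x y with h | h | h
    exacts [Or.inr (Or.inl h), Or.inl h, Or.inr (Or.inr h)])
    c A hA hinf hpred hle hno ψ hψok S₀ hsat
  have hcl := cl_theta hmu ψ hψs hψok
  have hbd := theta_bdd ψ hψok hψb
  refine hbig.trans_le ((Order.le_succ _).trans ((succ_mk_le_hanfVal hbd _ S hS).trans ?_))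
  exact le_csSup (bddAbove_hanf_II mu hmu) ⟨_, _, hcl.1, hcl.2, hbd, rfl⟩

/-- The vocabulary with constants from `I`. -/
def constL (I : Type) : FirstOrder.Language.{0,0} :=
  ⟨fun n => match n with | 0 => I | _ + 1 => Empty, fun _ => Empty⟩

/-- The constants as terms. -/
def cT {I : Type} (i : I) : (constL I).Term ℕ :=
  Language.Term.func (l := 0) (show (constL I).Functions 0 from i) (fun j => j.elim0)

/-- Every element is the value of a constant. -/
def covS (I : Type) : Fml (constL I) :=
  .all 0 (.not (.conj I fun i => .not (.eq (.var 0) (cT i))))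

/-- The structure on `I` naming every element by itself. -/
def covM (I : Type) : (constL I).Structure I where
  funMap := fun {n} => match n with
    | 0 => fun i _ => i
    | _ + 1 => fun e _ => e.elim
  RelMap := fun e _ => e.elim

theorem lt_hanf_II_succ (lam : Cardinal.{0}) (hlam : ℵ₀ ≤ lam) :
    lam < hanfNum (LIIInf (Order.succ lam)) := by
  obtain ⟨I, hI⟩ : ∃ I : Type, #I = lam := ⟨_, Cardinal.mk_out _⟩
  have : Infinite I := Cardinal.infinite_iff.2 (hI ▸ hlam)
  have hs : IsSentence (covS I) := by
    refine ⟨?_, ?_, ?_⟩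
    · simp [covS, fv, tvars, cT]
    · simp [covS, sv]
    · simp [covS, rv]
  have hok : Ok (LIIInf (Order.succ lam)) (covS I) := by
    refine ⟨?_, fun i => trivial⟩
    rw [hI]
    exact Order.lt_succ lam
  have hb : BddSpec (covS I) := by
    refine ⟨Order.succ lam, fun M S hM => Order.lt_succ_iff.2 ?_⟩
    rcases isEmpty_or_nonempty M with hE | ⟨⟨m⟩⟩
    · rw [Cardinal.mk_eq_zero]
      exact zero_le
    · rw [← hI]
      refine Cardinal.mk_le_of_surjective (f := fun i => (cT i).realize fun _ => m) ?_
      intro a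
      have h := hM (fun _ => m) (fun _ => ∅) (fun _ _ _ => False) a
      by_contra hno
      apply h
      intro i hi
      apply hno
      refine ⟨i, ?_⟩
      have h2 : (Function.update (fun _ => m) 0 a : ℕ → M) 0 = a := by simp
      refine Eq.trans ?_ (hi.symm.trans h2)
      simp only [cT, Language.Term.realize]
      congr 1
      funext j
      exact j.elim0
  have hsat : @Sat _ I (covM I) (covS I) := by
    intro va vs vr a h
    refine h a ?_
    show (Function.update va 0 a) 0 = _
    simp
    rfl
  have h1 := succ_mk_le_hanfVal hb I (covM I) hsat
  rw [hI] at h1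
  refine (Order.lt_succ lam).trans_le (h1.trans ?_)
  exact le_csSup (bddAbove_hanf_II _ (hlam.trans (Order.le_succ _))) ⟨_, _, hs, hok, hb, rfl⟩

/-- For all infinite cardinals `λ` and `μ`, if `λ < h(L^{II}_{μ,ω})` then
`h(L^c_{λ⁺,ω}) < h(L^{II}_{μ,ω})`; in particular `h(L^c_{λ⁺,ω}) < h(L^{II}_{λ⁺,ω})`. -/
theorem hanf_c_succ_lt_hanf_II :
    ∀ lam mu : Cardinal.{0}, ℵ₀ ≤ lam → ℵ₀ ≤ mu →
      (lam < hanfNum (LIIInf mu) →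
        hanfNum (LcInf (Order.succ lam)) < hanfNum (LIIInf mu)) ∧
      hanfNum (LcInf (Order.succ lam)) < hanfNum (LIIInf (Order.succ lam)) := by
  intro lam mu hlam hmu
  exact ⟨main_first lam mu hlam hmu, main_first lam (Order.succ lam) hlam
    (hlam.trans (Order.le_succ _)) (lt_hanf_II_succ lam hlam)⟩

end Hanf
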